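/- arXiv:1805.01816 — 2 statements merged into one kernel-verified Lean document; each statement's English description precedes it below -/
import Mathlib

section
/- Fix an integer d ≥ 2 and let K be a perfect and infinite field with char K = 0 or char K > d. Then for every closed subset X of Λ^d with X ⊊ Λ^d, there exists an N ∈ ℕ such that for all finite-dimensional K-vector spaces V, every element of X(V) has strength at most N. -/
noncomputable section

/-- A function `F : M → K` on a `K`-vector space `M` is a *polynomial function* if it lies in
the `K`-subalgebra of `M → K` generated by the linear functionals on `M`. -/
def IsPolyFun (K : Type) [Field K] {M : Type} [AddCommGroup M] [Module K M]
    (F : M → K) : Prop :=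
  F ∈ Algebra.adjoin K (Set.range fun l : M →ₗ[K] K => (l : M → K))

/-- A subset of a finite-dimensional `K`-vector space `M` is *Zariski closed* if it is the
common zero locus of a collection of polynomial functions on `M`. -/
def IsZariskiClosed (K : Type) [Field K] {M : Type} [AddCommGroup M] [Module K M]
    (C : Set M) : Prop :=
  ∃ S : Set (M → K), (∀ F ∈ S, IsPolyFun K F) ∧ C = {x | ∀ F ∈ S, F x = 0}

/-- `q ∈ Λ^d M` admits a strength decomposition with exactly `k` terms:
`q = r 0 ∧ s 0 + ⋯ + r (k-1) ∧ s (k-1)` with `r i ∈ Λ^{e i} M`, `s i ∈ Λ^{d - e i} M`, and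
`e i ∈ {1, …, d-1}`.  (The wedge product is the product of the exterior algebra.) -/
def ExtDecomp (K : Type) [Field K] (d : ℕ) {M : Type} [AddCommGroup M] [Module K M]
    (q : ExteriorAlgebra K M) (k : ℕ) : Prop :=
  ∃ (e : Fin k → ℕ) (r s : Fin k → ExteriorAlgebra K M),
    (∀ i, 1 ≤ e i) ∧ (∀ i, e i ≤ d - 1) ∧
    (∀ i, r i ∈ ⋀[K]^(e i) M) ∧ (∀ i, s i ∈ ⋀[K]^(d - e i) M) ∧
    q = ∑ i, r i * s i

/-- The strength of an alternating tensor `q ∈ Λ^d M` is at most `N`. -/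
def ExtStrengthLe (K : Type) [Field K] (d : ℕ) {M : Type} [AddCommGroup M] [Module K M]
    (q : ExteriorAlgebra K M) (N : ℕ) : Prop :=
  ∃ k ≤ N, ExtDecomp K d q k

/-- A closed subset `X` of the functor `Λ^d` over `K`: a rule assigning to each `n` (that is,
to the vector space `K^n`) a subset `X(K^n) ⊆ Λ^d K^n` which is Zariski closed in `Λ^d K^n`
and such that for every linear map `φ : K^n → K^m` the induced map `Λ^d φ` maps `X(K^n)`
into `X(K^m)`. -/
structure ClosedSubsetWedge (K : Type) [Field K] (d : ℕ) where
  carrier : ∀ n : ℕ, Set (ExteriorAlgebra K (Fin n → K))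
  mem_wedge : ∀ n, ∀ q ∈ carrier n, q ∈ ⋀[K]^d (Fin n → K)
  closed : ∀ n, IsZariskiClosed K
    {q : ⋀[K]^d (Fin n → K) | (q : ExteriorAlgebra K (Fin n → K)) ∈ carrier n}
  map_mem : ∀ {n m : ℕ} (φ : (Fin n → K) →ₗ[K] (Fin m → K)),
    ∀ q ∈ carrier n, ExteriorAlgebra.map φ q ∈ carrier m

open MvPolynomial in
/-- Over a perfect field, a nonconstant polynomial all of whose partial derivatives vanish is a
proper power. -/
theorem MvPolynomial.exists_totalDegree_lt_of_pderiv_eq_zero {K σ : Type*} [Field K]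
    [PerfectField K] {p : MvPolynomial σ K} (hp : p.totalDegree ≠ 0)
    (hder : ∀ i, pderiv i p = 0) :
    ∃ (g : MvPolynomial σ K) (l : ℕ), g.totalDegree < p.totalDegree ∧ g ^ l = p := by
  have hsupp : ∀ s ∈ p.support, ∀ i, (s i : K) = 0 := by
    intro s hs i
    by_cases hi : s i = 0
    · simp [hi]
    have h := coeff_pderiv (i := i) p (s - Finsupp.single i 1)
    have hle : Finsupp.single i 1 ≤ s := by
      simpa [Finsupp.single_le_iff] using Nat.one_le_iff_ne_zero.2 hi
    rw [hder i, coeff_zero, tsub_add_cancel_of_le hle] at h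
    have hc := (mul_eq_zero.1 h.symm).resolve_left (mem_support_iff.1 hs)
    have hs' : s i = (s - Finsupp.single i 1 : σ →₀ ℕ) i + 1 := by
      simp; omega
    rw [hs']
    exact_mod_cast hc
  obtain ⟨l, hl⟩ := ExpChar.exists K
  cases hl with
  | zero =>
    refine absurd ?_ hp
    rw [totalDegree_eq_zero_iff]
    intro s hs i
    exact_mod_cast hsupp s hs i
  | prime hprime =>
    have : Fact l.Prime := ⟨hprime⟩
    have : ExpChar K l := ExpChar.prime hprime
    choose r hr using fun a : K => surjective_frobenius K l a
    have hg : (∑ s ∈ p.support,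
        monomial (s.mapRange (· / l) (Nat.zero_div l)) (r (coeff s p))) ^ l = p := by
      rw [sum_pow_char]
      conv_rhs => rw [p.as_sum]
      refine Finset.sum_congr rfl fun s hs => ?_
      rw [monomial_pow]
      have h1 : r (coeff s p) ^ l = coeff s p := hr _
      have h2 : l • s.mapRange (· / l) (Nat.zero_div l) = s := by
        ext i
        simpa using Nat.mul_div_cancel' ((CharP.cast_eq_zero_iff K l _).1 (hsupp s hs i))
      rw [h1, h2]
    refine ⟨_, l, ?_, hg⟩
    set g := ∑ s ∈ p.support,
        monomial (s.mapRange (· / l) (Nat.zero_div l)) (r (coeff s p)) with hgdef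
    have hg0 : g ≠ 0 := by
      rintro h
      rw [h, zero_pow hprime.ne_zero] at hg
      simp [← hg] at hp
    have hdeg : ∀ k, (g ^ k).totalDegree = k * g.totalDegree := by
      intro k
      induction k with
      | zero => simp
      | succ k ih =>
        rw [pow_succ, totalDegree_mul_of_isDomain (pow_ne_zero _ hg0) hg0, ih]; ring
    rw [← hg, hdeg] at hp ⊢
    have := hprime.two_le
    have : 0 < g.totalDegree := Nat.pos_of_ne_zero (by rintro h; simp [h] at hp)
    nlinarith

open MvPolynomial in
theorem MvPolynomial.totalDegree_pderiv_lt {R σ : Type*} [CommSemiring R] {p : MvPolynomial σ R}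
    (i : σ) (hp : p.totalDegree ≠ 0) : (pderiv i p).totalDegree < p.totalDegree := by
  refine (Finset.sup_lt_iff (Nat.pos_of_ne_zero hp)).2 fun s hs => ?_
  rw [mem_support_iff, coeff_pderiv] at hs
  have h := le_totalDegree (mem_support_iff.2 (left_ne_zero_of_mul hs))
  rw [Finsupp.sum_add_index' (by simp) (by simp), Finsupp.sum_single_index rfl] at h
  exact h

section Strength

variable {K : Type} [Field K] {d : ℕ} {M : Type} [AddCommGroup M] [Module K M]

theorem ExtStrengthLe.mono {q : ExteriorAlgebra K M} {N N' : ℕ} (h : ExtStrengthLe K d q N)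
    (hN : N ≤ N') : ExtStrengthLe K d q N' :=
  let ⟨k, hk, hq⟩ := h
  ⟨k, hk.trans hN, hq⟩

theorem ExtStrengthLe.zero (N : ℕ) : ExtStrengthLe K d (0 : ExteriorAlgebra K M) N :=
  ⟨0, N.zero_le, ![], ![], ![], by simp, by simp, by simp, by simp, by simp⟩

theorem ExtStrengthLe.smul {q : ExteriorAlgebra K M} {N : ℕ} (h : ExtStrengthLe K d q N)
    (c : K) : ExtStrengthLe K d (c • q) N := by
  obtain ⟨k, hk, e, r, s, h1, h2, h3, h4, rfl⟩ := h
  exact ⟨k, hk, e, fun i => c • r i, s, h1, h2, fun i => Submodule.smul_mem _ _ (h3 i), h4, by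
    simp [Finset.smul_sum]⟩

theorem ExtStrengthLe.add {q q' : ExteriorAlgebra K M} {N N' : ℕ} (h : ExtStrengthLe K d q N)
    (h' : ExtStrengthLe K d q' N') : ExtStrengthLe K d (q + q') (N + N') := by
  obtain ⟨k, hk, e, r, s, h1, h2, h3, h4, rfl⟩ := h
  obtain ⟨k', hk', e', r', s', h1', h2', h3', h4', rfl⟩ := h'
  refine ⟨k + k', add_le_add hk hk', Fin.append e e', Fin.append r r', Fin.append s s',
    ?_, ?_, ?_, ?_, ?_⟩
  · exact Fin.addCases (by simpa using h1) (by simpa using h1')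
  · exact Fin.addCases (by simpa using h2) (by simpa using h2')
  · exact Fin.addCases (by simpa using h3) (by simpa using h3')
  · exact Fin.addCases (by simpa using h4) (by simpa using h4')
  · simp [Fin.sum_univ_add]

theorem ExtStrengthLe.sum {ι : Type*} (t : Finset ι) {q : ι → ExteriorAlgebra K M}
    (h : ∀ i ∈ t, ExtStrengthLe K d (q i) 1) : ExtStrengthLe K d (∑ i ∈ t, q i) t.card := by
  classical
  induction t using Finset.induction_on with
  | empty => simpa using ExtStrengthLe.zero 0
  | insert a t ha ih =>
    rw [Finset.sum_insert ha, Finset.card_insert_of_notMem ha, add_comm t.card]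
    exact (h a (Finset.mem_insert_self _ _)).add
      (ih fun i hi => h i (Finset.mem_insert_of_mem hi))

end Strength

/-- The alternating tensor `∑ F(b₁, …, b_d) e_{b₁} ∧ ⋯ ∧ e_{b_d}` attached to an arbitrary array
of scalars `F`. -/
def wedgeSum {K : Type} [Field K] {d m : ℕ} :
    ((Fin d → Fin m) → K) →ₗ[K] ExteriorAlgebra K (Fin m → K) :=
  ∑ b : Fin d → Fin m, (LinearMap.proj (R := K) (φ := fun _ : Fin d → Fin m => K) b).smulRight
    (ExteriorAlgebra.ιMulti K d (Pi.basisFun K (Fin m) ∘ b))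

section WedgeSum

variable {K : Type} [Field K] {m : ℕ}

theorem wedgeSum_apply {d : ℕ} (F : (Fin d → Fin m) → K) :
    wedgeSum F = ∑ b, F b • ExteriorAlgebra.ιMulti K d (Pi.basisFun K (Fin m) ∘ b) := by
  simp [wedgeSum]

theorem wedgeSum_mem {d : ℕ} (F : (Fin d → Fin m) → K) :
    wedgeSum F ∈ ⋀[K]^d (Fin m → K) := by
  rw [wedgeSum_apply]
  exact Submodule.sum_mem _ fun b _ => Submodule.smul_mem _ _
    (ExteriorAlgebra.ιMulti_range K d (Set.mem_range_self _))

/-- Up to sign, `wedgeSum` is multiplicative with respect to a shuffle of the indices. -/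
theorem wedgeSum_shuffle {e l : ℕ} (E : Fin e ⊕ Fin l ≃ Fin (e + l))
    (G₁ : (Fin e → Fin m) → K) (G₂ : (Fin l → Fin m) → K) :
    wedgeSum (fun b => G₁ (b ∘ E ∘ Sum.inl) * G₂ (b ∘ E ∘ Sum.inr)) =
      Equiv.Perm.sign (E.symm.trans finSumFinEquiv) • (wedgeSum G₁ * wedgeSum G₂) := by
  simp only [wedgeSum_apply]
  rw [← ((E.arrowCongr (Equiv.refl (Fin m))).symm.trans
    (Equiv.sumArrowEquivProdArrow _ _ _)).symm.sum_comp, Fintype.sum_prod_type,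
    Finset.sum_mul_sum, Finset.smul_sum]
  refine Finset.sum_congr rfl fun a _ => ?_
  rw [Finset.smul_sum]
  refine Finset.sum_congr rfl fun c _ => ?_
  rw [smul_mul_smul_comm, ExteriorAlgebra.ιMulti_mul_ιMulti, smul_comm,
    ← AlternatingMap.map_perm]
  refine congrArg₂ _ (congrArg₂ _ (congrArg G₁ ?_) (congrArg G₂ ?_)) (congrArg _ ?_)
  · ext1 i
    simp [Equiv.sumArrowEquivProdArrow]
  · ext1 i
    simp [Equiv.sumArrowEquivProdArrow]
  · ext1 i
    obtain ⟨j, rfl⟩ := E.surjective i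
    rcases j with j | j <;> simp [Equiv.sumArrowEquivProdArrow]

/-- An array which is a product of two arrays in complementary nonempty groups of indices
defines a tensor of strength at most one. -/
theorem strength_wedgeSum_mul {d : ℕ} (S : Finset (Fin d)) (hS : S.Nonempty) (hS' : Sᶜ.Nonempty)
    {F₁ F₂ : (Fin d → Fin m) → K} (h₁ : DependsOn F₁ S) (h₂ : DependsOn F₂ (Sᶜ : Finset (Fin d))) :
    ExtStrengthLe K d (wedgeSum (fun b => F₁ b * F₂ b)) 1 := by
  obtain ⟨e, he⟩ : ∃ e, S.card = e := ⟨_, rfl⟩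
  obtain ⟨l, hl⟩ : ∃ l, Sᶜ.card = l := ⟨_, rfl⟩
  have hd : d = e + l := by simpa [he, hl] using (Finset.card_add_card_compl S).symm
  have he0 : 0 < e := he ▸ hS.card_pos
  have hl0 : 0 < l := hl ▸ hS'.card_pos
  subst hd
  set E := finSumEquivOfFinset he hl with hE
  obtain ⟨G₁, hG₁⟩ : ∃ G₁ : (Fin e → Fin m) → K, F₁ = G₁ ∘ fun b => b ∘ E ∘ Sum.inl := by
    refine (Function.factorsThrough_iff _).1 fun b b' h => h₁ fun i hi => ?_
    obtain ⟨k, rfl⟩ : i ∈ Set.range (S.orderEmbOfFin he) := by simpa using hi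
    exact congrFun h k
  obtain ⟨G₂, hG₂⟩ : ∃ G₂ : (Fin l → Fin m) → K, F₂ = G₂ ∘ fun b => b ∘ E ∘ Sum.inr := by
    refine (Function.factorsThrough_iff _).1 fun b b' h => h₂ fun i hi => ?_
    obtain ⟨k, rfl⟩ : i ∈ Set.range (Sᶜ.orderEmbOfFin hl) := by simpa using hi
    exact congrFun h k
  have h := wedgeSum_shuffle E G₁ G₂
  refine ⟨1, le_rfl, fun _ => e,
    fun _ => Equiv.Perm.sign (E.symm.trans finSumFinEquiv) • wedgeSum G₁, fun _ => wedgeSum G₂,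
    fun _ => he0, fun _ => Nat.le_sub_of_add_le (Nat.add_le_add_left hl0 e),
    fun _ => ?_, fun _ => ?_, ?_⟩
  · rw [Units.smul_def]
    exact zsmul_mem (wedgeSum_mem G₁) _
  · simpa using wedgeSum_mem G₂
  · rw [Fin.sum_univ_one, smul_mul_assoc, ← h, hG₁, hG₂]
    rfl

end WedgeSum

section Local

open MvPolynomial

/-- Families of polynomials, indexed by `ι → B`, in which the coefficient of every monomial only
depends on the indices of the variables occurring in that monomial. -/
def localPolys (K ι B : Type*) [Field K] : Subalgebra K ((ι → B) → MvPolynomial ι K) where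
  carrier := {g | ∀ s : ι →₀ ℕ, DependsOn (fun b => coeff s (g b)) s.support}
  mul_mem' := by
    classical
    intro g h hg hh s b b' hb
    simp only [Pi.mul_apply, coeff_mul]
    refine Finset.sum_congr rfl fun x hx => ?_
    rw [Finset.HasAntidiagonal.mem_antidiagonal] at hx
    refine congrArg₂ _ (hg x.1 fun i hi => hb i ?_) (hh x.2 fun i hi => hb i ?_)
    all_goals
      simp only [← hx, Finset.mem_coe, Finsupp.mem_support_iff, Finsupp.add_apply] at hi ⊢
      omega
  add_mem' := by
    intro g h hg hh s b b' hb
    simp only [Pi.add_apply, coeff_add]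
    exact congrArg₂ _ (hg s hb) (hh s hb)
  algebraMap_mem' := fun r s b b' _ => rfl

variable {K : Type} [Field K] {d m : ℕ}

theorem ite_X_mem_localPolys {ι B : Type*} [DecidableEq B] (k : ι) (x : B) :
    (fun b : ι → B => if b k = x then (X k : MvPolynomial ι K) else 0) ∈ localPolys K ι B := by
  classical
  intro s b b' hb
  by_cases hs : k ∈ s.support
  · simp only [hb k hs]
  · have h : ∀ c : ι → B, coeff s (if c k = x then (X k : MvPolynomial ι K) else 0) = 0 := by
      intro c
      split_ifs
      · rw [coeff_X, if_neg]
        rintro rfl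
        simp at hs
      · simp
    simp only [h]

/-- The exponent of the monomial `∏ᵢ Xᵢ`. -/
def allOnes (d : ℕ) : Fin d →₀ ℕ := Finsupp.equivFunOnFinite.symm 1

@[simp]
theorem allOnes_apply (i : Fin d) : allOnes d i = 1 := rfl

theorem allOnes_ne_zero (hd : 0 < d) : allOnes d ≠ 0 := fun h => by
  simpa using DFunLike.congr_fun h ⟨0, hd⟩

/-- The multilinear part of a product of two local families is given by the Leibniz rule up to
terms of bounded strength. -/
theorem strength_wedgeSum_coeff_mul (hd : 0 < d)
    {g h : (Fin d → Fin m) → MvPolynomial (Fin d) K}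
    (hg : g ∈ localPolys K (Fin d) (Fin m)) (hh : h ∈ localPolys K (Fin d) (Fin m)) :
    ExtStrengthLe K d (wedgeSum fun b => coeff (allOnes d) (g b * h b) -
      (coeff (allOnes d) (g b) * coeff 0 (h b) + coeff 0 (g b) * coeff (allOnes d) (h b)))
      (Finset.HasAntidiagonal.antidiagonal (allOnes d)).card := by
  classical
  set A := Finset.HasAntidiagonal.antidiagonal (allOnes d)
  set B := (A.erase (0, allOnes d)).erase (allOnes d, 0) with hB
  have h0 := allOnes_ne_zero hd
  have key : (fun b => coeff (allOnes d) (g b * h b) -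
      (coeff (allOnes d) (g b) * coeff 0 (h b) + coeff 0 (g b) * coeff (allOnes d) (h b))) =
      ∑ x ∈ B, fun b => coeff x.1 (g b) * coeff x.2 (h b) := by
    ext b
    rw [Finset.sum_apply, coeff_mul, ← Finset.add_sum_erase A _ (a := (0, allOnes d)) (by simp [A]),
      ← Finset.add_sum_erase (A.erase (0, allOnes d)) _ (a := (allOnes d, 0)) (by simp [A, h0])]
    ring
  rw [key, map_sum]
  refine (ExtStrengthLe.sum B fun x hx => ?_).mono
    (Finset.card_le_card ((Finset.erase_subset _ _).trans (Finset.erase_subset _ _)))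
  obtain ⟨x, y⟩ := x
  simp only [B, A, Finset.mem_erase, Finset.HasAntidiagonal.mem_antidiagonal, ne_eq, Prod.mk.injEq] at hx
  obtain ⟨hx1, hx2, hxy⟩ := hx
  have hi : ∀ i, x i + y i = 1 := fun i => by simpa using DFunLike.congr_fun hxy i
  have hc : x.supportᶜ = y.support := by
    ext i
    have := hi i
    simp only [Finset.mem_compl, Finsupp.mem_support_iff]
    omega
  refine strength_wedgeSum_mul x.support ?_ ?_ (hg x) (hc ▸ hh y)
  · rw [Finsupp.support_nonempty_iff]
    rintro rfl
    exact hx2 ⟨rfl, by simpa using hxy⟩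
  · rw [hc, Finsupp.support_nonempty_iff]
    rintro rfl
    exact hx1 ⟨by simpa using hxy, rfl⟩

/-- Taking the multilinear part of `p(g)` is, up to terms of bounded strength, the derivative of
`p` at the constant terms of `g`. -/
theorem exists_strength_wedgeSum_aeval (hd : 0 < d) {σ : Type} [Fintype σ]
    (p : MvPolynomial σ K) :
    ∃ N : ℕ, ∀ (m : ℕ) (g : σ → (Fin d → Fin m) → MvPolynomial (Fin d) K) (c : σ → K),
      (∀ j, g j ∈ localPolys K (Fin d) (Fin m)) → (∀ j b, coeff 0 (g j b) = c j) →
      ExtStrengthLe K d (wedgeSum fun b => coeff (allOnes d) (aeval (fun j => g j b) p) -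
        ∑ k, eval c (pderiv k p) * coeff (allOnes d) (g k b)) N := by
  classical
  induction p using MvPolynomial.induction_on with
  | C a =>
    refine ⟨0, fun m g c hg hc => ?_⟩
    convert ExtStrengthLe.zero 0
    rw [← map_zero (wedgeSum (K := K) (d := d) (m := m))]
    congr 1
    ext b
    simp [algebraMap_eq, coeff_C, (allOnes_ne_zero hd).symm]
  | add p q hp hq =>
    obtain ⟨N, hN⟩ := hp
    obtain ⟨N', hN'⟩ := hq
    refine ⟨N + N', fun m g c hg hc => ?_⟩
    convert (hN m g c hg hc).add (hN' m g c hg hc) using 1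
    rw [← map_add]
    congr 1
    ext b
    simp only [map_add, coeff_add, add_mul, Finset.sum_add_distrib, Pi.add_apply]
    ring
  | mul_X p j hp =>
    obtain ⟨N, hN⟩ := hp
    refine ⟨(Finset.HasAntidiagonal.antidiagonal (allOnes d)).card + N, fun m g c hg hc => ?_⟩
    have hpg : (fun b => aeval (fun j => g j b) p) ∈ localPolys K (Fin d) (Fin m) := by
      have h : (fun b => aeval (fun j => g j b) p) = aeval g p := by
        ext1 b
        exact (comp_aeval_apply (f := g) (Pi.evalAlgHom K _ b) p).symm
      rw [h, Subalgebra.mvPolynomial_aeval_coe (localPolys K (Fin d) (Fin m))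
        (fun j => ⟨g j, hg j⟩) p]
      exact Subtype.coe_prop _
    have h0 : ∀ b, coeff 0 (aeval (fun j => g j b) p) = eval c p := by
      intro b
      rw [← constantCoeff_eq, map_aeval]
      have h : (constantCoeff (R := K) (σ := Fin d)).comp C = RingHom.id K := by ext; simp
      simp only [constantCoeff_eq, hc, algebraMap_eq, h]
      rfl
    convert (strength_wedgeSum_coeff_mul hd hpg (hg j)).add ((hN m g c hg hc).smul (c j)) using 1
    rw [← map_smul, ← map_add]
    congr 1
    ext b
    simp only [Pi.add_apply, Pi.smul_apply, smul_eq_mul, h0, hc, map_mul, aeval_X, pderiv_mul,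
      map_add, eval_X, pderiv_X, Pi.single_apply, add_mul, Finset.sum_add_distrib]
    have : ∑ x, eval c p * eval c (if j = x then 1 else 0) * coeff (allOnes d) (g x b) =
        eval c p * coeff (allOnes d) (g j b) := by
      rw [Finset.sum_eq_single j] <;> simp +contextual [eq_comm]
    rw [this]
    simp only [mul_right_comm _ (c j), ← Finset.sum_mul]
    ring

end Local

section Pencil

open MvPolynomial Set.powersetCard

variable {K : Type} [Field K] {d m n : ℕ}

/-- The coordinates of an alternating tensor on `K^n` with respect to the standard basis. -/
def wedgeCoord (n : ℕ) (J : Set.powersetCard (Fin n) d) :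
    ⋀[K]^d (Fin n → K) →ₗ[K] K :=
  exteriorPower.ιMultiDual K d (Pi.basisFun K (Fin n)) J

theorem wedgeCoord_ιMulti (J : Set.powersetCard (Fin n) d) (v : Fin d → Fin n → K) :
    wedgeCoord n J (exteriorPower.ιMulti K d v) =
      (Matrix.of fun i j => v i (ofFinEmbEquiv.symm J j)).det := by
  simp [wedgeCoord]

theorem sum_wedgeCoord_smul (q : ⋀[K]^d (Fin n → K)) :
    ∑ s, wedgeCoord n s q •
      exteriorPower.ιMulti K d (Pi.basisFun K (Fin n) ∘ ofFinEmbEquiv.symm s) = q := by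
  conv_rhs => rw [← ((Pi.basisFun K (Fin n)).exteriorPower d).sum_repr q]
  simp only [exteriorPower.basis_repr_apply, exteriorPower.basis_apply]
  rfl

/-- The linear map `φ + ∑ₖ tₖ e_{I(k)} ⊗ e_{b(k)}^*`. -/
def pencil (φ : (Fin m → K) →ₗ[K] (Fin n → K)) (I : Set.powersetCard (Fin n) d)
    (b : Fin d → Fin m) (t : Fin d → K) : (Fin m → K) →ₗ[K] (Fin n → K) :=
  φ + ∑ k, t k • (LinearMap.proj (b k)).smulRight (Pi.basisFun K (Fin n) (ofFinEmbEquiv.symm I k))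

/-- The matrix coefficients of `pencil`, as polynomials in `t`. -/
def pencilEntry (φ : (Fin m → K) →ₗ[K] (Fin n → K)) (I : Set.powersetCard (Fin n) d)
    (b : Fin d → Fin m) (x : Fin m) (y : Fin n) : MvPolynomial (Fin d) K :=
  C (φ (Pi.basisFun K (Fin m) x) y) +
    ∑ k, if ofFinEmbEquiv.symm I k = y then (if b k = x then X k else 0) else 0

theorem eval_pencilEntry (φ : (Fin m → K) →ₗ[K] (Fin n → K)) (I : Set.powersetCard (Fin n) d)
    (b : Fin d → Fin m) (x : Fin m) (y : Fin n) (t : Fin d → K) :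
    eval t (pencilEntry φ I b x y) = pencil φ I b t (Pi.basisFun K (Fin m) x) y := by
  simp only [pencilEntry, pencil, map_add, eval_C, map_sum, LinearMap.add_apply, Pi.add_apply,
    LinearMap.sum_apply, Finset.sum_apply]
  congr 1
  refine Finset.sum_congr rfl fun k _ => ?_
  by_cases h1 : ofFinEmbEquiv.symm I k = y <;> by_cases h2 : b k = x <;>
    simp [h1, h2]

/-- The coordinate at `J` of the image of `q` under `pencil`, as a polynomial in `t`. -/
def pencilCoord (φ : (Fin m → K) →ₗ[K] (Fin n → K)) (q : ⋀[K]^d (Fin m → K))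
    (I J : Set.powersetCard (Fin n) d) (b : Fin d → Fin m) : MvPolynomial (Fin d) K :=
  ∑ s, C (wedgeCoord m s q) * (Matrix.of fun i j => pencilEntry φ I b
    (ofFinEmbEquiv.symm s i) (ofFinEmbEquiv.symm J j)).det

variable (φ : (Fin m → K) →ₗ[K] (Fin n → K)) (q : ⋀[K]^d (Fin m → K))
  (I J : Set.powersetCard (Fin n) d)

theorem eval_pencilCoord (b : Fin d → Fin m) (t : Fin d → K) :
    eval t (pencilCoord φ q I J b) = wedgeCoord n J (exteriorPower.map d (pencil φ I b t) q) := by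
  conv_rhs => rw [← sum_wedgeCoord_smul q]
  simp only [pencilCoord, map_sum, map_mul, eval_C, map_smul, exteriorPower.map_apply_ιMulti,
    wedgeCoord_ιMulti, smul_eq_mul, RingHom.map_det]
  refine Finset.sum_congr rfl fun s _ => ?_
  congr 2
  ext i j
  simp [eval_pencilEntry]

theorem coeff_zero_pencilCoord (b : Fin d → Fin m) :
    coeff 0 (pencilCoord φ q I J b) = wedgeCoord n J (exteriorPower.map d φ q) := by
  rw [← constantCoeff_eq, ← eval_zero, eval_pencilCoord]
  simp [pencil]

theorem pencilEntry_mem_localPolys (x : Fin m) (y : Fin n) :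
    (fun b => pencilEntry φ I b x y) ∈ localPolys K (Fin d) (Fin m) := by
  have h : (fun b => pencilEntry φ I b x y) =
      algebraMap K ((Fin d → Fin m) → MvPolynomial (Fin d) K) (φ (Pi.basisFun K (Fin m) x) y) +
      ∑ k, if ofFinEmbEquiv.symm I k = y
        then (fun b : Fin d → Fin m => if b k = x then (X k : MvPolynomial (Fin d) K) else 0)
        else 0 := by
    ext1 b
    rw [Pi.add_apply, Finset.sum_apply, pencilEntry]
    refine congrArg (C (φ (Pi.basisFun K (Fin m) x) y) + ·) (Finset.sum_congr rfl fun k _ => ?_)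
    by_cases hy : ofFinEmbEquiv.symm I k = y <;> simp [hy]
  rw [h]
  refine Subalgebra.add_mem _ (Subalgebra.algebraMap_mem _ _) (Subalgebra.sum_mem _ fun k _ => ?_)
  split_ifs
  · exact ite_X_mem_localPolys k _
  · exact Subalgebra.zero_mem _

theorem pencilCoord_mem_localPolys :
    pencilCoord φ q I J ∈ localPolys K (Fin d) (Fin m) := by
  have h : pencilCoord φ q I J = ∑ s,
      algebraMap K ((Fin d → Fin m) → MvPolynomial (Fin d) K) (wedgeCoord m s q) *
        ∑ σ : Equiv.Perm (Fin d), (Equiv.Perm.sign σ : ℤ) • ∏ i, fun b => pencilEntry φ I b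
          (ofFinEmbEquiv.symm s (σ i)) (ofFinEmbEquiv.symm J i) := by
    ext1 b
    simp only [pencilCoord, Finset.sum_apply, Pi.mul_apply, Matrix.det_apply, Pi.smul_apply,
      Finset.prod_apply, Matrix.of_apply, Units.smul_def]
    rfl
  rw [h]
  refine Subalgebra.sum_mem _ fun s _ => Subalgebra.mul_mem _ (Subalgebra.algebraMap_mem _ _) ?_
  refine Subalgebra.sum_mem _ fun σ _ => Subalgebra.zsmul_mem _ ?_ _
  exact Subalgebra.prod_mem _ fun i _ => pencilEntry_mem_localPolys φ I _ _

theorem coeff_allOnes_eq_zero_of_mem_supported {k : Fin d} {p : MvPolynomial (Fin d) K}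
    (hp : p ∈ supported K ({k}ᶜ : Set (Fin d))) : coeff (allOnes d) p = 0 := by
  by_contra hne
  have := mem_supported.1 hp
    ((mem_vars_iff_mem_support k).2 ⟨allOnes d, mem_support_iff.2 hne, by simp⟩)
  simp at this

theorem coeff_pencilCoord_of_ne (hIJ : J ≠ I) (b : Fin d → Fin m) :
    coeff (allOnes d) (pencilCoord φ q I J b) = 0 := by
  obtain ⟨y, hyI, hyJ⟩ := (exists_mem_notMem_iff_ne I J).1 hIJ.symm
  obtain ⟨k, rfl⟩ := (mem_range_ofFinEmbEquiv_symm_iff_mem I y).2 hyI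
  have hJ : ∀ j, ofFinEmbEquiv.symm I k ≠ ofFinEmbEquiv.symm J j := fun j h =>
    hyJ (h ▸ (mem_range_ofFinEmbEquiv_symm_iff_mem J _).1 ⟨j, rfl⟩)
  have hmem : pencilCoord φ q I J b ∈ supported K ({k}ᶜ : Set (Fin d)) := by
    refine Subalgebra.sum_mem _ fun s _ => Subalgebra.mul_mem _ (Subalgebra.algebraMap_mem _ _) ?_
    rw [Matrix.det_apply]
    refine Subalgebra.sum_mem _ fun σ _ => ?_
    rw [Units.smul_def]
    refine Subalgebra.zsmul_mem _ (Subalgebra.prod_mem _ fun i _ => ?_) _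
    refine Subalgebra.add_mem _ (Subalgebra.algebraMap_mem _ _) (Subalgebra.sum_mem _ fun l _ => ?_)
    split_ifs with h1 h2
    · refine X_mem_supported.2 ?_
      rintro rfl
      exact hJ _ h1
    all_goals exact Subalgebra.zero_mem _
  exact coeff_allOnes_eq_zero_of_mem_supported hmem

theorem coeff_allOnes_prod (u v : Fin d → K) :
    coeff (allOnes d) (∏ k, (C (u k) + C (v k) * X k)) = ∏ k, v k := by
  rw [Finset.prod_add, coeff_sum, Finset.sum_eq_single ∅]
  · have h : (∏ k, X k : MvPolynomial (Fin d) K) = monomial (allOnes d) 1 := by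
      rw [monomial_eq, Finsupp.prod_fintype] <;> simp
    simp [Finset.prod_mul_distrib, ← map_prod, h]
  · intro S _ hS
    obtain ⟨k, hk⟩ := Finset.nonempty_iff_ne_empty.2 hS
    have hmem : (∏ i ∈ S, C (u i)) * ∏ i ∈ Finset.univ \ S, C (v i) * X i ∈
        supported K ({k}ᶜ : Set (Fin d)) := by
      refine Subalgebra.mul_mem _ (Subalgebra.prod_mem _ fun i _ => Subalgebra.algebraMap_mem _ _)
        (Subalgebra.prod_mem _ fun i hi => Subalgebra.mul_mem _ (Subalgebra.algebraMap_mem _ _) ?_)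
      refine X_mem_supported.2 ?_
      rintro rfl
      simp [hk] at hi
    exact coeff_allOnes_eq_zero_of_mem_supported hmem
  · simp

theorem coeff_pencilCoord_self (b : Fin d → Fin m) :
    coeff (allOnes d) (pencilCoord φ q I I b) = ∑ s, wedgeCoord m s q *
      (Matrix.of fun i j => if b j = ofFinEmbEquiv.symm s i then (1 : K) else 0).det := by
  simp only [pencilCoord, coeff_sum, coeff_C_mul]
  refine Finset.sum_congr rfl fun s _ => ?_
  congr 1
  simp only [Matrix.det_apply, coeff_sum, Units.smul_def, coeff_smul, Matrix.of_apply]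
  refine Finset.sum_congr rfl fun σ _ => ?_
  congr 1
  rw [← coeff_allOnes_prod fun k => φ (Pi.basisFun K (Fin m) (ofFinEmbEquiv.symm s (σ k)))
    (ofFinEmbEquiv.symm I k)]
  congr 1
  refine Finset.prod_congr rfl fun k _ => ?_
  rw [pencilEntry, Finset.sum_eq_single k]
  · simp
  · intro l _ hl
    simp [hl]
  · simp

/-- Contracting `q` with all tuples of dual basis vectors and reassembling multiplies by `d!`. -/
theorem wedgeSum_contract :
    wedgeSum (fun b => ∑ s, wedgeCoord m s q *
      (Matrix.of fun i j => if b j = ofFinEmbEquiv.symm s i then (1 : K) else 0).det) =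
      (d.factorial : K) • (q : ExteriorAlgebra K (Fin m → K)) := by
  have h : ∀ s : Set.powersetCard (Fin m) d, wedgeSum (fun b =>
      (Matrix.of fun i j => if b j = ofFinEmbEquiv.symm s i then (1 : K) else 0).det) =
      (d.factorial : K) • ExteriorAlgebra.ιMulti K d
        (Pi.basisFun K (Fin m) ∘ ofFinEmbEquiv.symm s) := by
    intro s
    simp only [wedgeSum_apply, Matrix.det_apply, Finset.sum_smul, Matrix.of_apply]
    rw [Finset.sum_comm]
    have : ∀ σ : Equiv.Perm (Fin d), ∑ b : Fin d → Fin m, (Equiv.Perm.sign σ •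
        ∏ i, if b i = ofFinEmbEquiv.symm s (σ i) then (1 : K) else 0) •
          ExteriorAlgebra.ιMulti K d (Pi.basisFun K (Fin m) ∘ b) =
        ExteriorAlgebra.ιMulti K d (Pi.basisFun K (Fin m) ∘ ofFinEmbEquiv.symm s) := by
      intro σ
      rw [Finset.sum_eq_single (ofFinEmbEquiv.symm s ∘ σ)]
      · simp only [Function.comp_apply, if_true, Finset.prod_const_one]
        rw [← Function.comp_assoc, AlternatingMap.map_perm, smul_assoc, one_smul, smul_smul]
        simp
      · intro b _ hb
        obtain ⟨i, hi⟩ := Function.ne_iff.1 hb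
        rw [Finset.prod_eq_zero (Finset.mem_univ i) (if_neg hi), smul_zero, zero_smul]
      · simp
    rw [Finset.sum_congr rfl fun σ _ => this σ, Finset.sum_const, Finset.card_univ,
      Fintype.card_perm, Fintype.card_fin, Nat.cast_smul_eq_nsmul]
  conv_rhs => rw [← sum_wedgeCoord_smul q]
  have h' : (fun b : Fin d → Fin m => ∑ s, wedgeCoord m s q *
      (Matrix.of fun i j => if b j = ofFinEmbEquiv.symm s i then (1 : K) else 0).det) =
      ∑ s, wedgeCoord m s q • fun b =>
      (Matrix.of fun i j => if b j = ofFinEmbEquiv.symm s i then (1 : K) else 0).det := by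
    ext b
    simp
  rw [h', map_sum]
  simp only [map_smul, h, Submodule.coe_sum, Submodule.coe_smul, exteriorPower.ιMulti_apply_coe,
    Finset.smul_sum]
  exact Finset.sum_congr rfl fun s _ => smul_comm _ _ _

/-- A tensor all of whose images in `⋀^d K^n` are zeros of a fixed nonzero polynomial has bounded
strength. -/
theorem exists_strength_le_of_forall_eval_map_eq_zero [PerfectField K] [Infinite K] (hd : 0 < d)
    (hfac : (d.factorial : K) ≠ 0) (n : ℕ) (p : MvPolynomial (Set.powersetCard (Fin n) d) K)
    (hp : p ≠ 0) :
    ∃ N : ℕ, ∀ (m : ℕ) (q : ⋀[K]^d (Fin m → K)),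
      (∀ φ : (Fin m → K) →ₗ[K] (Fin n → K),
        eval (fun J => wedgeCoord n J (exteriorPower.map d φ q)) p = 0) →
      ExtStrengthLe K d (q : ExteriorAlgebra K (Fin m → K)) N := by
  induction hD : p.totalDegree using Nat.strong_induction_on generalizing p with
  | _ D ih =>
  subst hD
  by_cases hdeg : p.totalDegree = 0
  · rw [totalDegree_eq_zero_iff_eq_C] at hdeg
    refine ⟨0, fun m q hq => absurd (hq 0) ?_⟩
    rw [hdeg, eval_C]
    rintro h
    exact hp (by rw [hdeg, h, C_0])
  by_cases hder : ∀ I, pderiv I p = 0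
  · obtain ⟨g, l, hg, rfl⟩ := exists_totalDegree_lt_of_pderiv_eq_zero hdeg hder
    have hg0 : g ≠ 0 := by
      rintro rfl
      rcases eq_or_ne l 0 with rfl | hl
      · simp at hdeg
      · simp [hl] at hp
    obtain ⟨N, hN⟩ := ih _ hg g hg0 rfl
    exact ⟨N, fun m q hq => hN m q fun φ =>
      eq_zero_of_pow_eq_zero ((map_pow _ _ _).symm.trans (hq φ))⟩
  push Not at hder
  obtain ⟨I, hI⟩ := hder
  have hlt := totalDegree_pderiv_lt I hdeg
  obtain ⟨N₁, hN₁⟩ := ih _ hlt _ hI rfl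
  obtain ⟨N₂, hN₂⟩ := exists_strength_wedgeSum_aeval hd p
  refine ⟨max N₁ N₂, fun m q hq => ?_⟩
  by_cases hall : ∀ φ : (Fin m → K) →ₗ[K] (Fin n → K),
      eval (fun J => wedgeCoord n J (exteriorPower.map d φ q)) (pderiv I p) = 0
  · exact (hN₁ m q hall).mono (le_max_left _ _)
  push Not at hall
  obtain ⟨φ, hφ⟩ := hall
  have h := hN₂ m (pencilCoord φ q I) (fun J => wedgeCoord n J (exteriorPower.map d φ q))
    (pencilCoord_mem_localPolys φ q I) (coeff_zero_pencilCoord φ q I)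
  set a := eval (fun J => wedgeCoord n J (exteriorPower.map d φ q)) (pderiv I p)
  have hzero : ∀ b : Fin d → Fin m, aeval (fun J => pencilCoord φ q I J b) p = 0 := by
    intro b
    refine MvPolynomial.funext fun t => ?_
    rw [map_zero, ← hq (pencil φ I b t)]
    simp only [← eval_pencilCoord φ q I _ b t]
    exact (eval₂Hom_congr (by ext; simp) rfl rfl).trans (map_aeval _ (eval t) p).symm |>.symm
  have hF : (fun b => coeff (allOnes d) (aeval (fun J => pencilCoord φ q I J b) p) -
      ∑ J, eval (fun J => wedgeCoord n J (exteriorPower.map d φ q)) (pderiv J p) *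
        coeff (allOnes d) (pencilCoord φ q I J b)) =
      (-a) • fun b => ∑ s, wedgeCoord m s q *
        (Matrix.of fun i j => if b j = ofFinEmbEquiv.symm s i then (1 : K) else 0).det := by
    ext b
    rw [hzero, Finset.sum_eq_single I]
    · simp [coeff_pencilCoord_self, a]
    · intro J _ hJ
      rw [coeff_pencilCoord_of_ne φ q I J hJ, mul_zero]
    · simp
  rw [hF, map_smul, wedgeSum_contract, smul_smul] at h
  have h' := (h.smul (-a * d.factorial)⁻¹).mono (le_max_right N₁ N₂)
  rwa [smul_smul, inv_mul_cancel₀ (mul_ne_zero (neg_ne_zero.2 hφ) hfac), one_smul] at h'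

end Pencil

open MvPolynomial in
theorem IsPolyFun.exists_mvPolynomial {K : Type} [Field K] {d n : ℕ}
    {F : ⋀[K]^d (Fin n → K) → K} (hF : IsPolyFun K F) :
    ∃ p : MvPolynomial (Set.powersetCard (Fin n) d) K,
      ∀ x, F x = eval (fun J => wedgeCoord n J x) p := by
  have hle : Algebra.adjoin K (Set.range fun l : ⋀[K]^d (Fin n → K) →ₗ[K] K =>
      (l : ⋀[K]^d (Fin n → K) → K)) ≤
      (aeval fun J (x : ⋀[K]^d (Fin n → K)) => wedgeCoord (K := K) (d := d) n J x).range := by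
    refine Algebra.adjoin_le ?_
    rintro _ ⟨l, rfl⟩
    refine ⟨∑ J, C (l (exteriorPower.ιMulti K d
      (Pi.basisFun K (Fin n) ∘ Set.powersetCard.ofFinEmbEquiv.symm J))) * X J, ?_⟩
    ext x
    conv_rhs => rw [← sum_wedgeCoord_smul x]
    simp [mul_comm]
  obtain ⟨p, rfl⟩ := hle hF
  refine ⟨p, fun x => ?_⟩
  exact comp_aeval_apply (f := fun J (x : ⋀[K]^d (Fin n → K)) => wedgeCoord (K := K) n J x)
    (Pi.evalAlgHom K (fun _ : ⋀[K]^d (Fin n → K) => K) x) p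

theorem exteriorPower.coe_map {K : Type} [Field K] {d m n : ℕ}
    (φ : (Fin m → K) →ₗ[K] (Fin n → K)) (q : ⋀[K]^d (Fin m → K)) :
    (exteriorPower.map d φ q : ExteriorAlgebra K (Fin n → K)) = ExteriorAlgebra.map φ q := by
  have h : (⋀[K]^d (Fin n → K)).subtype ∘ₗ exteriorPower.map d φ =
      (ExteriorAlgebra.map φ).toLinearMap ∘ₗ (⋀[K]^d (Fin m → K)).subtype := by
    ext v
    simp [ExteriorAlgebra.map_apply_ιMulti]
  exact LinearMap.congr_fun h q

/-- **Theorem (main theorem for alternating tensors).** Fix `d ≥ 2` and let `K` be a perfect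
infinite field with `char K = 0` or `char K > d`. For every closed subset `X ⊊ Λ^d` there is
an `N` such that for every finite-dimensional vector space (i.e. every `K^n`), all elements
of `X(K^n)` have strength at most `N`. -/
theorem strength_bounded_of_closed_proper_Wedge
    (K : Type) [Field K] [PerfectField K] [Infinite K]
    (d : ℕ) (hd : 2 ≤ d) (hchar : ringChar K = 0 ∨ d < ringChar K)
    (X : ClosedSubsetWedge K d)
    (hX : ∃ n, X.carrier n ≠ (⋀[K]^d (Fin n → K) : Set (ExteriorAlgebra K (Fin n → K)))) :
    ∃ N : ℕ, ∀ n : ℕ, ∀ q ∈ X.carrier n, ExtStrengthLe K d q N := by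
  obtain ⟨n, hn⟩ := hX
  obtain ⟨S, hS, hS'⟩ := X.closed n
  obtain ⟨x, hx, hxX⟩ : ∃ x ∈ ⋀[K]^d (Fin n → K), x ∉ X.carrier n := by
    by_contra! h
    exact hn (Set.Subset.antisymm (X.mem_wedge n) h)
  obtain ⟨F, hFS, hFx⟩ : ∃ F ∈ S, F ⟨x, hx⟩ ≠ 0 := by
    by_contra! h
    have hmem : (⟨x, hx⟩ : ⋀[K]^d (Fin n → K)) ∈ {y | ∀ F ∈ S, F y = 0} := h
    rw [← hS'] at hmem
    exact hxX hmem
  obtain ⟨p, hp⟩ := (hS F hFS).exists_mvPolynomial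
  have hp0 : p ≠ 0 := by
    rintro rfl
    exact hFx (by rw [hp, map_zero])
  have hfac : (d.factorial : K) ≠ 0 := by
    intro h
    have hdvd := (ringChar.spec K _).1 h
    rcases hchar with h0 | h0
    · rw [h0, zero_dvd_iff] at hdvd
      exact d.factorial_ne_zero hdvd
    · have hprime : (ringChar K).Prime :=
        (CharP.char_is_prime_or_zero K (ringChar K)).resolve_right (by omega)
      exact absurd (hprime.dvd_factorial.1 hdvd) (by omega)
  obtain ⟨N, hN⟩ := exists_strength_le_of_forall_eval_map_eq_zero (by omega) hfac n p hp0
  refine ⟨N, fun m q hq => hN m ⟨q, X.mem_wedge m q hq⟩ fun φ => ?_⟩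
  rw [← hp]
  have hmem : exteriorPower.map d φ ⟨q, X.mem_wedge m q hq⟩ ∈
      {y : ⋀[K]^d (Fin n → K) | (y : ExteriorAlgebra K (Fin n → K)) ∈ X.carrier n} := by
    rw [Set.mem_ofPred_eq, exteriorPower.coe_map]
    exact X.map_mem φ q hq
  rw [hS'] at hmem
  exact hmem F hFS

end
end

section
/- Fix an integer d ≥ 2 and let K be a perfect and infinite field with char K = 0 or char K > d. If q ∈ S^d_∞ has infinite strength, then the GL_∞-orbit of q is dense in S^d_∞ with respect to the inverse limit topology. -/
open MvPolynomial

noncomputable section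

/-- `q ∈ S^d K^n` admits a strength decomposition with exactly `k` terms:
`q = r 0 * s 0 + ⋯ + r (k-1) * s (k-1)` with `r i` homogeneous of degree `e i ∈ {1, …, d-1}`
and `s i` homogeneous of degree `d - e i`. -/
def HasStrengthDecomp (K : Type) [Field K] (d : ℕ) {n : ℕ}
    (q : MvPolynomial (Fin n) K) (k : ℕ) : Prop :=
  ∃ (e : Fin k → ℕ) (r s : Fin k → MvPolynomial (Fin n) K),
    (∀ i, 1 ≤ e i) ∧ (∀ i, e i ≤ d - 1) ∧
    (∀ i, (r i).IsHomogeneous (e i)) ∧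
    (∀ i, (s i).IsHomogeneous (d - e i)) ∧
    q = ∑ i, r i * s i

/-- The strength of `q ∈ S^d K^n` is at most `N`. -/
def StrengthLe (K : Type) [Field K] (d : ℕ) {n : ℕ}
    (q : MvPolynomial (Fin n) K) (N : ℕ) : Prop :=
  ∃ k ≤ N, HasStrengthDecomp K d q k

/-- The algebra homomorphism `S φ : Sym(K^n) → Sym(K^m)` induced by a linear map
`φ : K^n → K^m`; it restricts to `S^d φ : S^d K^n → S^d K^m` in each degree. -/
def polyMapAlg (K : Type) [Field K] {n m : ℕ} (φ : (Fin n → K) →ₗ[K] (Fin m → K)) :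
    MvPolynomial (Fin n) K →ₐ[K] MvPolynomial (Fin m) K :=
  aeval fun i => ∑ j, φ (Pi.single i 1) j • X j

/-- The Zariski topology on a `K`-vector space: the topology generated by the complements of
hypersurfaces `{x | F x ≠ 0}` for polynomial functions `F`; its closed sets are exactly the
Zariski closed sets. -/
def zariskiTopology (K : Type) [Field K] (M : Type) [AddCommGroup M] [Module K M] :
    TopologicalSpace M :=
  TopologicalSpace.generateFrom
    {U | ∃ F : M → K, IsPolyFun K F ∧ U = {x | F x ≠ 0}}

/-- The map `S^d π : S^d K^{n+1} → S^d K^n` induced by the coordinate projection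
`π : K^{n+1} → K^n` forgetting the last coordinate: it sets the last variable to `0`. -/
def truncMap (K : Type) [Field K] (n : ℕ) :
    MvPolynomial (Fin (n + 1)) K →ₐ[K] MvPolynomial (Fin n) K :=
  aeval fun i : Fin (n + 1) => if h : (i : ℕ) < n then X (⟨i, h⟩ : Fin n) else 0

/-- `S^d_∞ = lim← S^d K^n`, the inverse limit of the spaces of degree-`d` homogeneous
polynomials along the maps `S^d π`. -/
def SdInf (K : Type) [Field K] (d : ℕ) : Type :=
  {q : ∀ n, homogeneousSubmodule (Fin n) K d //
    ∀ n, truncMap K n (↑(q (n + 1))) = (↑(q n) : MvPolynomial (Fin n) K)}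

/-- Each `S^d K^n` carries the Zariski topology. -/
instance sdZariski (K : Type) [Field K] (d n : ℕ) :
    TopologicalSpace (homogeneousSubmodule (Fin n) K d) :=
  zariskiTopology K _

/-- `S^d_∞` carries the inverse limit topology: the topology induced from the product of the
Zariski topologies. -/
instance sdInfTop (K : Type) [Field K] (d : ℕ) : TopologicalSpace (SdInf K d) :=
  instTopologicalSpaceSubtype

/-- The linear map `K^m → K^m` (for `n₀ ≤ m`) acting as `g` on the first `n₀` coordinates and
as the identity on the remaining ones: the image of `g ∈ GL_{n₀}` in `GL_m` applied to
vectors. -/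
def extendMap (K : Type) [Field K] {n₀ m : ℕ} (h : n₀ ≤ m)
    (g : (Fin n₀ → K) →ₗ[K] (Fin n₀ → K)) : (Fin m → K) →ₗ[K] (Fin m → K) where
  toFun v i := if h' : (i : ℕ) < n₀ then g (fun j => v (Fin.castLE h j)) ⟨i, h'⟩ else v i
  map_add' u v := by
    funext i
    simp only [Pi.add_apply]
    split_ifs with h'
    · have : (fun j => u (Fin.castLE h j) + v (Fin.castLE h j))
          = (fun j => u (Fin.castLE h j)) + fun j => v (Fin.castLE h j) := rfl
      rw [this, map_add]
      rfl
    · rfl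
  map_smul' c v := by
    funext i
    simp only [Pi.smul_apply, RingHom.id_apply]
    split_ifs with h'
    · have : (fun j => c • v (Fin.castLE h j)) = c • fun j => v (Fin.castLE h j) := rfl
      rw [this, map_smul]
      rfl
    · rfl

/-- The `GL_∞`-orbit of `q ∈ S^d_∞`, where `GL_∞ = ⋃_n GL_n(K)`: the set of all `q'` obtained
from `q` by the action of some `g ∈ GL_{n₀}(K)`; `g` acts on the level-`m` component
(for `m ≥ n₀`) through its extension to `GL_m(K)`, and the lower components are determined by
compatibility. -/
def glInfOrbit (K : Type) [Field K] (d : ℕ) (q : SdInf K d) : Set (SdInf K d) :=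
  {q' | ∃ (n₀ : ℕ) (g : (Fin n₀ → K) ≃ₗ[K] (Fin n₀ → K)),
    ∀ (m : ℕ) (h : n₀ ≤ m),
      (↑(q'.1 m) : MvPolynomial (Fin m) K)
        = polyMapAlg K (extendMap K h g.toLinearMap) (↑(q.1 m))}

namespace MvPolynomial

/-- The homogeneous components of a product with a homogeneous factor. -/
theorem IsHomogeneous.homogeneousComponent_mul {σ R : Type*} [CommRing R] {f : MvPolynomial σ R}
    {k : ℕ} (hf : f.IsHomogeneous k) (j : ℕ) (g : MvPolynomial σ R) :
    homogeneousComponent (k + j) (f * g) = f * homogeneousComponent j g := by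
  induction g using MvPolynomial.monomial_add_induction_on with
  | C a =>
    rw [homogeneousComponent_of_mem (hf.mul (isHomogeneous_C σ a)),
      homogeneousComponent_of_mem (isHomogeneous_C σ a)]
    by_cases h : j = 0 <;> simp [h]
  | monomial_add s a g _ _ ih =>
    have hs := isHomogeneous_monomial (R := R) a (rfl : s.degree = s.degree)
    rw [mul_add, map_add, map_add, ih, mul_add, homogeneousComponent_of_mem (hf.mul hs),
      homogeneousComponent_of_mem hs]
    by_cases h : j = s.degree <;> simp [h]

/-- First-order Taylor expansion of a polynomial along `a + q b`, modulo `q ^ 2`. -/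
theorem exists_aeval_add_mul_eq {ι K R : Type*} [Fintype ι] [CommRing K] [CommRing R] [Algebra K R]
    (a b : ι → K) (q : R) (G : MvPolynomial ι K) :
    ∃ s : R, aeval (fun i => algebraMap K R (a i) + algebraMap K R (b i) * q) G =
      algebraMap K R (eval a G) + algebraMap K R (∑ i, b i * eval a (pderiv i G)) * q
        + q * (q * s) := by
  classical
  induction G using MvPolynomial.induction_on with
  | C c => exact ⟨0, by simp⟩
  | add p p' hp hp' =>
    obtain ⟨s, hs⟩ := hp
    obtain ⟨s', hs'⟩ := hp'
    refine ⟨s + s', ?_⟩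
    simp only [map_add, hs, hs', mul_add, Finset.sum_add_distrib]
    ring
  | mul_X p j hp =>
    obtain ⟨s, hs⟩ := hp
    have hsum : ∑ i, b i * eval a (pderiv i (p * X j)) =
        (∑ i, b i * eval a (pderiv i p)) * a j + eval a p * b j := by
      simp only [pderiv_mul, pderiv_X, map_add, map_mul, eval_X, mul_add, Finset.sum_add_distrib,
        Finset.sum_mul, Pi.single_apply, mul_assoc]
      congr 1
      simp [apply_ite, mul_comm]
    rw [map_mul, hs, aeval_X, hsum]
    refine ⟨algebraMap K R (∑ i, b i * eval a (pderiv i p)) * algebraMap K R (b j)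
      + s * (algebraMap K R (a j) + algebraMap K R (b j) * q), ?_⟩
    simp only [map_add, map_mul, eval_X]
    ring

/-- Over a perfect field, a polynomial whose partial derivatives all vanish is constant, or a
`p`-th power where `p` is the (prime) characteristic. -/
theorem eq_C_or_eq_pow_of_pderiv_eq_zero {ι K : Type*} [Field K] [PerfectField K]
    {F : MvPolynomial ι K} (hF : ∀ i, pderiv i F = 0) :
    (∃ c, F = C c) ∨ ∃ p, 2 ≤ p ∧ ∃ G : MvPolynomial ι K, F = G ^ p := by
  have key : ∀ s ∈ F.support, ∀ i, (s i : K) = 0 := by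
    intro s hs i
    by_cases h0 : s i = 0
    · simp [h0]
    have h1 := congrArg (coeff (s - Finsupp.single i 1)) (hF i)
    have h2 : s - Finsupp.single i 1 + Finsupp.single i 1 = s :=
      tsub_add_cancel_of_le (by simpa [Finsupp.single_le_iff] using Nat.one_le_iff_ne_zero.mpr h0)
    rw [coeff_pderiv, h2, coeff_zero] at h1
    rcases mul_eq_zero.mp h1 with h | h
    · exact absurd h (mem_support_iff.mp hs)
    · rw [← h2, Finsupp.add_apply, Finsupp.single_eq_same, Nat.cast_add, Nat.cast_one, h]
  obtain ⟨p, hp⟩ := CharP.exists K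
  rcases CharP.char_is_prime_or_zero K p with hpp | rfl
  · right
    have : Fact p.Prime := ⟨hpp⟩
    have : ExpChar K p := ExpChar.prime hpp
    refine ⟨p, hpp.two_le, ?_⟩
    have hmem : F ∈ (frobenius (MvPolynomial ι K) p).range := by
      rw [F.as_sum]
      refine sum_mem fun s hs => ?_
      obtain ⟨c, hc⟩ := surjective_frobenius K p (coeff s F)
      refine ⟨monomial (s.mapRange (· / p) (Nat.zero_div p)) c, ?_⟩
      rw [frobenius_def, monomial_pow, ← hc, frobenius_def]
      congr 2
      ext i
      have := (CharP.cast_eq_zero_iff K p (s i)).mp (key s hs i)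
      simp [Nat.mul_div_cancel' this]
    obtain ⟨G, hG⟩ := hmem
    exact ⟨G, hG.symm⟩
  · left
    have : CharZero K := CharP.charP_to_charZero K
    refine ⟨coeff 0 F, ?_⟩
    classical
    ext s
    rw [coeff_C]
    split_ifs with h
    · rw [h]
    · by_contra hs
      refine h (Eq.symm ?_)
      ext i
      exact_mod_cast key s (mem_support_iff.mpr hs) i

theorem totalDegree_pderiv_lt_s4 {ι K : Type*} [Field K] {F : MvPolynomial ι K} {i : ι}
    (h : pderiv i F ≠ 0) : (pderiv i F).totalDegree < F.totalDegree := by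
  have key : ∀ s ∈ (pderiv i F).support, (s.sum fun _ e => e) < F.totalDegree := by
    intro s hs
    have h1 : s + Finsupp.single i 1 ∈ F.support := by
      rw [mem_support_iff, coeff_pderiv] at hs
      exact mem_support_iff.mpr (left_ne_zero_of_mul hs)
    have h2 := le_totalDegree h1
    rw [Finsupp.sum_add_index' (fun _ => rfl) (fun _ _ _ => rfl),
      Finsupp.sum_single_index rfl] at h2
    omega
  obtain ⟨s, hs⟩ := Finset.nonempty_of_ne_empty (mt support_eq_empty.mp h)
  rw [totalDegree, Finset.sup_lt_iff (lt_of_le_of_lt (Nat.zero_le _) (key s hs))]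
  exact key

/-- If a nonzero polynomial over a perfect field vanishes on a nonempty set `Z`, then some
polynomial vanishing on `Z` has a partial derivative that does not vanish on `Z`. -/
theorem exists_pderiv_ne_zero_of_vanishing {ι K : Type*} [Field K] [PerfectField K]
    {Z : Set (ι → K)} (hZ : Z.Nonempty) {F : MvPolynomial ι K} (hF0 : F ≠ 0)
    (hF : ∀ x ∈ Z, eval x F = 0) :
    ∃ G : MvPolynomial ι K, (∀ x ∈ Z, eval x G = 0) ∧
      ∃ x ∈ Z, ∃ i, eval x (pderiv i G) ≠ 0 := by
  induction hn : F.totalDegree using Nat.strong_induction_on generalizing F with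
  | _ n ih =>
    subst hn
    by_cases hd : ∃ x ∈ Z, ∃ i, eval x (pderiv i F) ≠ 0
    · exact ⟨F, hF, hd⟩
    push Not at hd
    by_cases hz : ∃ i, pderiv i F ≠ 0
    · obtain ⟨i, hi⟩ := hz
      exact ih _ (totalDegree_pderiv_lt_s4 hi) hi (fun x hx => hd x hx i) rfl
    push Not at hz
    obtain ⟨x₀, hx₀⟩ := hZ
    rcases eq_C_or_eq_pow_of_pderiv_eq_zero hz with ⟨c, rfl⟩ | ⟨p, hp, G, rfl⟩
    · exact absurd (by simpa using hF x₀ hx₀) (by simpa using hF0)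
    · have hG0 : G ≠ 0 := by
        rintro rfl
        exact hF0 (zero_pow (by omega))
      have hG : ∀ x ∈ Z, eval x G = 0 := fun x hx =>
        pow_eq_zero_iff (by omega : p ≠ 0) |>.mp (by simpa using hF x hx)
      refine ih _ ?_ hG0 hG rfl
      obtain ⟨k, rfl⟩ := Nat.exists_eq_add_of_le hp
      have hdeg : (G ^ (2 + k)).totalDegree = G.totalDegree + G.totalDegree +
          (G ^ k).totalDegree := by
        rw [pow_add, totalDegree_mul_of_isDomain (pow_ne_zero _ hG0) (pow_ne_zero _ hG0), pow_two,
          totalDegree_mul_of_isDomain hG0 hG0]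
      have hpos : G.totalDegree ≠ 0 := by
        intro h
        rw [totalDegree_eq_zero_iff_eq_C] at h
        rw [h] at hG hG0
        exact absurd (by simpa using hG x₀ hx₀) (by simpa using hG0)
      omega

/-- Substitution of the linear forms given by the rows of `A` for the variables. -/
def linSubst {σ τ K R : Type*} [Fintype τ] [CommRing K] [CommRing R] [Algebra K R]
    (A : σ → τ → R) : MvPolynomial σ K →ₐ[K] MvPolynomial τ R :=
  aeval fun i => ∑ j, C (A i j) * X j

theorem map_linSubst {σ τ K R S : Type*} [Fintype τ] [CommRing K] [CommRing R] [Algebra K R]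
    [CommRing S] [Algebra K S] (e : R →ₐ[K] S) (A : σ → τ → R) (q : MvPolynomial σ K) :
    map (e : R →+* S) (linSubst A q) = linSubst (fun i j => e (A i j)) q := by
  have : (mapAlgHom e).comp (linSubst A) = linSubst (K := K) fun i j => e (A i j) := by
    ext i : 1
    simp [linSubst]
  exact DFunLike.congr_fun this q

theorem eval_coeff_linSubst {σ τ κ K R : Type*} [Fintype τ] [CommRing K] [CommRing R] [Algebra K R]
    (e : R →ₐ[K] K) (A : σ → τ → R) (q : MvPolynomial σ K) (s : κ → τ →₀ ℕ)
    (F : MvPolynomial κ K) :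
    e (aeval (fun i => coeff (s i) (linSubst A q)) F) =
      eval (fun i => coeff (s i) (linSubst (fun a b => e (A a b)) q)) F := by
  rw [← map_linSubst]
  simp only [coeff_map]
  rw [← AlgHom.comp_apply, comp_aeval]
  rfl

open Polynomial in
theorem natDegree_aeval_add_X_le {σ K S : Type*} [CommRing K] [CommRing S] [Algebra K S]
    (u v : σ → S) {d : ℕ} {q : MvPolynomial σ K} (hq : q.IsHomogeneous d) :
    (MvPolynomial.aeval (fun i => Polynomial.C (u i) + Polynomial.C (v i) * Polynomial.X) q
      : S[X]).natDegree ≤ d ∧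
    (MvPolynomial.aeval (fun i => Polynomial.C (u i) + Polynomial.C (v i) * Polynomial.X) q
      : S[X]).coeff d = MvPolynomial.aeval v q := by
  have h1 : ∀ i, (Polynomial.C (u i) + Polynomial.C (v i) * Polynomial.X).natDegree ≤ 1 := by
    intro i
    compute_degree
  have hmon : ∀ s : σ →₀ ℕ,
      (∏ i ∈ s.support, (Polynomial.C (u i) + Polynomial.C (v i) * Polynomial.X) ^ s i
        : S[X]).natDegree ≤ s.degree ∧
      (∏ i ∈ s.support, (Polynomial.C (u i) + Polynomial.C (v i) * Polynomial.X) ^ s i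
        : S[X]).coeff s.degree = ∏ i ∈ s.support, v i ^ s i := by
    classical
    intro s
    rw [Finsupp.degree_apply]
    induction s.support using Finset.induction_on with
    | empty => simp
    | insert a t ha ih =>
      have h2 := natDegree_pow_le_of_le (s a) (h1 a)
      rw [mul_one] at h2
      rw [Finset.prod_insert ha, Finset.prod_insert ha, Finset.sum_insert ha]
      refine ⟨natDegree_mul_le_of_le h2 ih.1, ?_⟩
      have h3 := coeff_pow_of_natDegree_le (m := s a) (h1 a)
      rw [mul_one] at h3
      rw [coeff_mul_add_eq_of_natDegree_le h2 ih.1, ih.2, h3]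
      simp
  rw [MvPolynomial.aeval_def, MvPolynomial.aeval_def, eval₂_eq, eval₂_eq]
  have hdeg : ∀ s ∈ q.support, s.degree = d := fun s hs => by
    have := hq (mem_support_iff.mp hs)
    rwa [Finsupp.degree_eq_weight_one]
  constructor
  · refine natDegree_sum_le_of_forall_le _ _ fun s hs => ?_
    rw [Polynomial.algebraMap_apply]
    exact (natDegree_C_mul_le _ _).trans ((hmon s).1.trans (hdeg s hs).le)
  · rw [finsetSum_coeff]
    refine Finset.sum_congr rfl fun s hs => ?_
    rw [Polynomial.algebraMap_apply, Polynomial.coeff_C_mul, ← hdeg s hs, (hmon s).2]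

theorem eval_aeval_C_add_C_mul_X {σ K S : Type*} [CommRing K] [CommRing S] [Algebra K S]
    (u v : σ → S) (x : S) (q : MvPolynomial σ K) :
    (aeval (fun i => Polynomial.C (u i) + Polynomial.C (v i) * Polynomial.X) q).eval x =
      aeval (fun i => u i + v i * x) q := by
  have : ((Polynomial.aeval x : Polynomial S →ₐ[S] S).restrictScalars K).comp
      (aeval fun i => Polynomial.C (u i) + Polynomial.C (v i) * Polynomial.X) =
      aeval (R := K) fun i => u i + v i * x := by
    ext i
    simp
  rw [← this]
  simp

/-- Bihomogeneity of a polynomial in an auxiliary variable: the coefficient of the `k`-th power has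
all its coefficients homogeneous of degree `k`. -/
def gradedSubalgebra (σ τ K : Type*) [CommRing K] :
    Subalgebra K (Polynomial (MvPolynomial τ (MvPolynomial σ K))) where
  carrier := {Q | ∀ k s, (coeff s (Q.coeff k)).IsHomogeneous k}
  mul_mem' := by
    classical
    intro P Q hP hQ k s
    rw [Polynomial.coeff_mul, coeff_sum]
    refine IsHomogeneous.sum _ _ _ fun x hx => ?_
    rw [coeff_mul]
    refine IsHomogeneous.sum _ _ _ fun y _ => ?_
    rw [← Finset.HasAntidiagonal.mem_antidiagonal.mp hx]
    exact (hP _ _).mul (hQ _ _)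
  add_mem' := by
    intro P Q hP hQ k s
    rw [Polynomial.coeff_add, coeff_add]
    exact (hP _ _).add (hQ _ _)
  algebraMap_mem' := by
    classical
    intro c k s
    rw [Polynomial.algebraMap_apply, Polynomial.coeff_C]
    split_ifs with h
    · rw [IsScalarTower.algebraMap_apply K (MvPolynomial σ K), algebraMap_eq, algebraMap_eq,
        coeff_C, h]
      split_ifs
      · exact isHomogeneous_C _ _
      · exact isHomogeneous_zero _ _ _
    · exact isHomogeneous_zero _ _ _

theorem C_add_C_mul_X_mem_gradedSubalgebra {σ τ K : Type*} [CommRing K]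
    {u v : MvPolynomial τ (MvPolynomial σ K)} (hu : ∀ s, (coeff s u).IsHomogeneous 0)
    (hv : ∀ s, (coeff s v).IsHomogeneous 1) :
    Polynomial.C u + Polynomial.C v * Polynomial.X ∈ gradedSubalgebra σ τ K := by
  intro k s
  rcases k with _ | _ | k
  · simpa using hu s
  · simpa using hv s
  · simp [isHomogeneous_zero]

theorem aeval_mem_gradedSubalgebra {σ τ K : Type*} [CommRing K]
    {f : σ → Polynomial (MvPolynomial τ (MvPolynomial σ K))}
    (hf : ∀ i, f i ∈ gradedSubalgebra σ τ K) (q : MvPolynomial σ K) :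
    aeval f q ∈ gradedSubalgebra σ τ K := by
  induction q using MvPolynomial.induction_on with
  | C c => rw [aeval_C]; exact Subalgebra.algebraMap_mem _ _
  | add p p' hp hp' => rw [map_add]; exact add_mem hp hp'
  | mul_X p i hp => rw [map_mul, aeval_X]; exact mul_mem hp (hf i)

theorem aeval_mul_right_of_isHomogeneous {σ K S : Type*} [CommRing K] [CommRing S] [Algebra K S]
    (g : σ → S) (L : S) {d : ℕ} {q : MvPolynomial σ K} (hq : q.IsHomogeneous d) :
    aeval (fun i => g i * L) q = aeval g q * L ^ d := by
  rw [aeval_def, aeval_def, eval₂_eq, eval₂_eq, Finset.sum_mul]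
  refine Finset.sum_congr rfl fun s hs => ?_
  have h := hq (mem_support_iff.mp hs)
  change Finsupp.weight 1 s = d at h
  replace h : ∑ i ∈ s.support, s i = d := by
    rw [← h, ← Finsupp.degree_apply, Finsupp.degree_eq_weight_one]
    rfl
  simp only [mul_pow, Finset.prod_mul_distrib, Finset.prod_pow_eq_pow_sum, h, mul_assoc]

/-- Expansion of the coefficients of `q` along the pencil of substitutions `A + x lᵀ`, graded by
the degree in the parameter `x`. -/
theorem exists_pencil_expansion {σ τ K : Type*} [Fintype τ] [CommRing K] {d : ℕ}
    {q : MvPolynomial σ K} (hq : q.IsHomogeneous d) (A : σ → τ → K) (l : τ → K) :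
    ∃ c : (τ →₀ ℕ) → ℕ → MvPolynomial σ K, (∀ s k, (c s k).IsHomogeneous k) ∧
      (∀ s, c s 0 = C (coeff s (linSubst A q))) ∧
      (∀ s, c s d = C (coeff s ((∑ j, l j • X j : MvPolynomial τ K) ^ d)) * q) ∧
      ∀ s, coeff s (linSubst (fun i j => C (A i j) + C (l j) * X i) q) =
        ∑ k ∈ Finset.range (d + 1), c s k := by
  let u : σ → MvPolynomial τ (MvPolynomial σ K) := fun i => ∑ j, C (C (A i j)) * X j
  let L : MvPolynomial τ (MvPolynomial σ K) := map C (∑ j, l j • X j)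
  let v : σ → MvPolynomial τ (MvPolynomial σ K) := fun i => C (X i) * L
  let Q : Polynomial (MvPolynomial τ (MvPolynomial σ K)) :=
    aeval (fun i => Polynomial.C (u i) + Polynomial.C (v i) * Polynomial.X) q
  have hu : ∀ i, u i = map C (∑ j, C (A i j) * X j) := fun i => by simp [u]
  obtain ⟨hQdeg, hQd⟩ := natDegree_aeval_add_X_le u v hq
  have hQmem : Q ∈ gradedSubalgebra σ τ K := by
    refine aeval_mem_gradedSubalgebra (fun i => ?_) q
    refine C_add_C_mul_X_mem_gradedSubalgebra (fun s => ?_) fun s => ?_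
    · rw [hu, coeff_map]
      exact isHomogeneous_C _ _
    · rw [coeff_C_mul, coeff_map, ← add_zero 1]
      exact (isHomogeneous_X _ _).mul (isHomogeneous_C _ _)
  refine ⟨fun s k => coeff s (Q.coeff k), fun s k => hQmem k s, fun s => ?_, fun s => ?_,
    fun s => ?_⟩
  · have h1 : Q.coeff 0 = linSubst (fun i j => C (A i j)) q := by
      rw [Polynomial.coeff_zero_eq_eval_zero, eval_aeval_C_add_C_mul_X]
      simp [u, linSubst]
    have h2 := map_linSubst (Algebra.ofId K (MvPolynomial σ K)) A q
    change _ = linSubst (fun i j => C (A i j)) q at h2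
    change coeff s (Q.coeff 0) = _
    rw [h1, ← h2, coeff_map]
    rfl
  · have h1 : aeval (fun i => C (X i)) q = (C q : MvPolynomial τ (MvPolynomial σ K)) := by
      have h2 : aeval (R := K) (fun i => C (X i)) = (IsScalarTower.toAlgHom K (MvPolynomial σ K)
          (MvPolynomial τ (MvPolynomial σ K))) := by
        ext i : 1
        simp [algebraMap_eq]
      rw [h2]
      rfl
    change coeff s (Q.coeff d) = _
    rw [hQd, aeval_mul_right_of_isHomogeneous _ _ hq, h1, coeff_C_mul, ← map_pow, coeff_map,
      mul_comm]
  · have h1 : linSubst (fun i j => C (A i j) + C (l j) * X i) q = Q.eval 1 := by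
      rw [eval_aeval_C_add_C_mul_X, linSubst]
      refine congrArg (fun f => aeval f q) (_root_.funext fun i => ?_)
      simp only [u, v, L, map_sum, smul_eq_C_mul, map_mul, map_add, map_C, map_X, add_mul,
        Finset.sum_add_distrib, Finset.mul_sum, mul_one]
      exact congrArg _ (Finset.sum_congr rfl fun j _ => by ring)
    rw [h1, Polynomial.eval_eq_sum_range' (Nat.lt_succ_of_le hQdeg), coeff_sum]
    simp [Q]

/-- The `d`-th powers of linear forms do not lie in a proper subspace of the forms of degree `d`
when `d!` is invertible. -/
theorem exists_sum_coeff_pow_mul_ne_zero {τ K : Type*} [Fintype τ] [Field K] [Infinite K] {d : ℕ}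
    (hfac : (d.factorial : K) ≠ 0) [Fintype {s : τ →₀ ℕ // s.degree = d}]
    {g : {s : τ →₀ ℕ // s.degree = d} → K} {i₀ : {s : τ →₀ ℕ // s.degree = d}} (hg : g i₀ ≠ 0) :
    ∃ l : τ → K, ∑ i, coeff i.1 ((∑ j, l j • X j : MvPolynomial τ K) ^ d) * g i ≠ 0 := by
  classical
  by_contra! h
  have h0 : ∑ i : {s : τ →₀ ℕ // s.degree = d},
      monomial i.1 ((i.1.multinomial : K) * g i) = 0 := by
    refine MvPolynomial.funext fun l => ?_
    rw [map_sum, map_zero, ← h l]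
    refine Finset.sum_congr rfl fun i _ => ?_
    have hi : (i.1.sum fun _ m => m) = d := i.2
    rw [coeff_linearCombination_X_pow_of_fintype, if_pos hi, eval_monomial]
    ring
  have h1 := congrArg (coeff i₀.1) h0
  rw [coeff_sum, Finset.sum_eq_single i₀, coeff_monomial, if_pos rfl, coeff_zero] at h1
  · refine (mul_ne_zero ?_ hg) h1
    intro h2
    apply hfac
    have h3 := Nat.multinomial_spec i₀.1.support i₀.1
    have hi : ∑ j ∈ i₀.1.support, i₀.1 j = d := i₀.2
    rw [hi] at h3
    rw [← h3, Nat.cast_mul]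
    exact mul_eq_zero_of_right _ h2
  · intro i _ hi
    rw [coeff_monomial, if_neg fun h => hi (Subtype.ext h)]
  · simp

end MvPolynomial

/-- If the coefficient vector of `q` is moved inside a hypersurface by every linear substitution,
then at points where the hypersurface is smooth this forces `q` to have bounded strength. -/
theorem strengthLe_of_vanishing {K : Type} [Field K] [Infinite K] {d m n : ℕ} (hd : 2 ≤ d)
    (hfac : (d.factorial : K) ≠ 0) {q : MvPolynomial (Fin m) K} (hq : q.IsHomogeneous d)
    {F : MvPolynomial {s : Fin n →₀ ℕ // s.degree = d} K}
    (hF : ∀ A : Fin m → Fin n → K, eval (fun i => coeff i.1 (linSubst A q)) F = 0)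
    (A : Fin m → Fin n → K) (i₀ : {s : Fin n →₀ ℕ // s.degree = d})
    (hA : eval (fun i => coeff i.1 (linSubst A q)) (pderiv i₀ F) ≠ 0) :
    StrengthLe K d q (Nat.card ({s : Fin n →₀ ℕ // s.degree = d} × Fin (d - 1))) := by
  classical
  have : Finite {s : Fin n →₀ ℕ // s.degree = d} := Finsupp.finite_of_degree_eq d
  let _ := Fintype.ofFinite {s : Fin n →₀ ℕ // s.degree = d}
  set a : {s : Fin n →₀ ℕ // s.degree = d} → K := fun i => coeff i.1 (linSubst A q)
  obtain ⟨l, hl⟩ := exists_sum_coeff_pow_mul_ne_zero hfac (g := fun i => eval a (pderiv i F)) hA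
  set b : {s : Fin n →₀ ℕ // s.degree = d} → K :=
    fun i => coeff i.1 ((∑ j, l j • X j : MvPolynomial (Fin n) K) ^ d)
  set ε := ∑ i, b i * eval a (pderiv i F)
  obtain ⟨c, hc, hc0, hcd, hsum⟩ := exists_pencil_expansion hq A l
  have hvan : aeval (fun i : {s : Fin n →₀ ℕ // s.degree = d} =>
      coeff i.1 (linSubst (fun i j => C (A i j) + C (l j) * X i) q)) F = 0 := by
    refine MvPolynomial.funext fun w => ?_
    have h1 := eval_coeff_linSubst (aeval w : MvPolynomial (Fin m) K →ₐ[K] K)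
      (fun i j => C (A i j) + C (l j) * X i) q
      (fun i : {s : Fin n →₀ ℕ // s.degree = d} => i.1) F
    rw [hF] at h1
    rw [map_zero, ← h1]
    rfl
  obtain ⟨s, hs⟩ := exists_aeval_add_mul_eq a b q F
  set J := Ideal.span (Set.range fun x : {s : Fin n →₀ ℕ // s.degree = d} × Fin (d - 1) =>
    c x.1 (x.2 + 1)) with hJ
  have hmemJ : algebraMap K _ ε * q + q * (q * s) ∈ J := by
    have h1 : Ideal.Quotient.mk J
          (aeval (fun i => algebraMap K _ (a i) + algebraMap K _ (b i) * q) F)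
        = Ideal.Quotient.mk J (aeval (fun i : {s : Fin n →₀ ℕ // s.degree = d} =>
          coeff i.1 (linSubst (fun i j => C (A i j) + C (l j) * X i) q)) F) := by
      rw [← Ideal.Quotient.mkₐ_eq_mk K, ← AlgHom.comp_apply, ← AlgHom.comp_apply, comp_aeval,
        comp_aeval]
      congr 2
      funext i
      rw [Ideal.Quotient.mkₐ_eq_mk, Ideal.Quotient.eq, hsum, ← neg_mem_iff]
      obtain ⟨e, rfl⟩ : ∃ e, d = e + 1 := ⟨d - 1, by omega⟩
      rw [Finset.sum_range_succ, Finset.sum_range_succ', hc0, hcd, algebraMap_eq]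
      have h2 : -(C (a i) + C (b i) * q - (∑ k ∈ Finset.range e, c i (k + 1) + C (a i)
          + C (b i) * q)) = ∑ k ∈ Finset.range e, c i (k + 1) := by ring
      rw [h2]
      refine sum_mem fun k hk => Ideal.subset_span ⟨(i, ⟨k, Finset.mem_range.mp hk⟩), rfl⟩
    rw [hvan, map_zero, hs, hF, map_zero, zero_add, Ideal.Quotient.eq_zero_iff_mem] at h1
    exact h1
  rw [hJ, Ideal.mem_span_range_iff_exists_fun] at hmemJ
  obtain ⟨r, hr⟩ := hmemJ
  have hqd : q = ∑ x : {s : Fin n →₀ ℕ // s.degree = d} × Fin (d - 1),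
      c x.1 (x.2 + 1) * (C ε⁻¹ * homogeneousComponent (d - (x.2 + 1)) (r x)) := by
    have h1 := congrArg (homogeneousComponent d) hr
    have h2 : homogeneousComponent d (q * (q * s)) = 0 := by
      have h3 := hq.homogeneousComponent_mul 0 (q * s)
      rw [add_zero] at h3
      rw [h3, homogeneousComponent_zero, ← constantCoeff_eq, map_mul, constantCoeff_eq,
        hq.coeff_eq_zero (by simp; omega)]
      simp
    rw [map_add, h2, add_zero, algebraMap_eq, homogeneousComponent_C_mul,
      homogeneousComponent_eq_self hq, map_sum] at h1
    have h4 : q = C ε⁻¹ * (C ε * q) := by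
      rw [← mul_assoc, ← C_mul, inv_mul_cancel₀ hl, C_1, one_mul]
    rw [h4, ← h1, Finset.mul_sum]
    refine Finset.sum_congr rfl fun x _ => ?_
    have hx := x.2.isLt
    have h5 := (hc x.1 (x.2 + 1)).homogeneousComponent_mul (d - (x.2 + 1)) (r x)
    rw [Nat.add_sub_cancel' (by omega)] at h5
    rw [mul_comm (r x), h5]
    ring
  refine ⟨_, le_rfl, ?_⟩
  let e := Finite.equivFin ({s : Fin n →₀ ℕ // s.degree = d} × Fin (d - 1))
  refine ⟨fun i => (e.symm i).2 + 1, fun i => c (e.symm i).1 ((e.symm i).2 + 1), fun i =>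
    C ε⁻¹ * homogeneousComponent (d - ((e.symm i).2 + 1)) (r (e.symm i)),
    fun _ => Nat.le_add_left 1 _, fun i => (e.symm i).2.isLt, fun i => hc _ _, fun i => ?_, ?_⟩
  · simpa using (isHomogeneous_C _ _).mul (homogeneousComponent_isHomogeneous _ _)
  · exact hqd.trans (e.symm.sum_comp _).symm

/-- A polynomial vanishing on the coefficient vectors of all invertible substitutions into `q`,
cut off to fewer variables, vanishes on those of all substitutions. -/
theorem eval_coeff_linSubst_eq_zero_of_linearEquiv {K : Type} [Field K] [Infinite K] {m n : ℕ}
    (h : n ≤ m) {κ : Type*} (s : κ → Fin n →₀ ℕ) (F : MvPolynomial κ K)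
    (q : MvPolynomial (Fin m) K)
    (hF : ∀ g : (Fin m → K) ≃ₗ[K] (Fin m → K), eval (fun i => coeff (s i)
      (linSubst (fun a b => g (Pi.single a 1) (Fin.castLE h b)) q)) F = 0)
    (A : Fin m → Fin n → K) : eval (fun i => coeff (s i) (linSubst A q)) F = 0 := by
  let B : Fin m → Fin n → MvPolynomial (Fin m × Fin m) K := fun a b => X (a, Fin.castLE h b)
  have heval : ∀ w : Fin m × Fin m → K, eval w (aeval (fun i => coeff (s i) (linSubst B q)) F) =
      eval (fun i => coeff (s i) (linSubst (fun a b => w (a, Fin.castLE h b)) q)) F := by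
    intro w
    have h1 := eval_coeff_linSubst (aeval w : MvPolynomial (Fin m × Fin m) K →ₐ[K] K) B q s F
    simp only [B, aeval_X] at h1
    exact h1
  have hzero : aeval (fun i => coeff (s i) (linSubst B q)) F = 0 := by
    refine eq_of_eval_eq_on_gl fun g => ?_
    rw [map_zero, heval]
    have h1 : (g : Matrix (Fin m) (Fin m) K).transpose * ((g⁻¹ : GL (Fin m) K) :
        Matrix (Fin m) (Fin m) K).transpose = 1 := by
      rw [← Matrix.transpose_mul, ← Units.val_mul, inv_mul_cancel, Units.val_one,
        Matrix.transpose_one]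
    have h2 : ((g⁻¹ : GL (Fin m) K) : Matrix (Fin m) (Fin m) K).transpose *
        (g : Matrix (Fin m) (Fin m) K).transpose = 1 := by
      rw [← Matrix.transpose_mul, ← Units.val_mul, mul_inv_cancel, Units.val_one,
        Matrix.transpose_one]
    rw [← hF (Matrix.toLin'OfInv h2 h1)]
    simp
  have h3 := heval fun x => if hx : (x.2 : ℕ) < n then A x.1 ⟨x.2, hx⟩ else 0
  rw [hzero, map_zero] at h3
  simpa using h3.symm

/-- Universality: a form of high strength has Zariski dense orbit after cutting off variables. -/
theorem strengthLe_of_vanishing_orbit {K : Type} [Field K] [PerfectField K] [Infinite K]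
    {d m n : ℕ} (hd : 2 ≤ d) (hfac : (d.factorial : K) ≠ 0) {q : MvPolynomial (Fin m) K}
    (hq : q.IsHomogeneous d) {F : MvPolynomial {s : Fin n →₀ ℕ // s.degree = d} K} (hF0 : F ≠ 0)
    (hF : ∀ A : Fin m → Fin n → K, eval (fun i => coeff i.1 (linSubst A q)) F = 0) :
    StrengthLe K d q (Nat.card ({s : Fin n →₀ ℕ // s.degree = d} × Fin (d - 1))) := by
  obtain ⟨G, hG, _, ⟨A, rfl⟩, i, hi⟩ := exists_pderiv_ne_zero_of_vanishing
    (Set.range_nonempty fun (A : Fin m → Fin n → K) (i : {s : Fin n →₀ ℕ // s.degree = d}) =>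
      coeff i.1 (linSubst A q)) hF0 (by rintro _ ⟨A, rfl⟩; exact hF A)
  exact strengthLe_of_vanishing hd hfac hq (fun A => hG _ ⟨A, rfl⟩) A i hi

theorem factorial_cast_ne_zero_of_lt_ringChar {K : Type*} [Field K] {d : ℕ}
    (hchar : ringChar K = 0 ∨ d < ringChar K) : (d.factorial : K) ≠ 0 := by
  rw [Ne, ringChar.spec]
  rcases hchar with h | h
  · rw [h, zero_dvd_iff]
    exact Nat.factorial_ne_zero d
  · rw [((CharP.char_is_prime_or_zero K (ringChar K)).resolve_right (by omega)).dvd_factorial]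
    omega

section PolyFun

variable {K : Type} [Field K] {M N : Type} [AddCommGroup M] [Module K M] [AddCommGroup N]
  [Module K N]

theorem IsPolyFun.comp_linearMap {F : N → K} (hF : IsPolyFun K F) (f : M →ₗ[K] N) :
    IsPolyFun K fun x => F (f x) := by
  unfold IsPolyFun at hF ⊢
  induction hF using Algebra.adjoin_induction with
  | mem G hG =>
    obtain ⟨l, rfl⟩ := hG
    exact Algebra.subset_adjoin ⟨l ∘ₗ f, rfl⟩
  | algebraMap c => exact Subalgebra.algebraMap_mem _ c
  | add G H _ _ hG hH => exact add_mem hG hH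
  | mul G H _ _ hG hH => exact mul_mem hG hH

theorem IsPolyFun.exists_subset_of_isOpen {U : Set M} {x : M}
    (hU : @IsOpen M (zariskiTopology K M) U) (hx : x ∈ U) :
    ∃ F : M → K, IsPolyFun K F ∧ F x ≠ 0 ∧ {y | F y ≠ 0} ⊆ U := by
  induction hU with
  | basic U hU =>
    obtain ⟨F, hF, rfl⟩ := hU
    exact ⟨F, hF, hx, subset_rfl⟩
  | univ => exact ⟨1, one_mem (Algebra.adjoin K _), one_ne_zero, Set.subset_univ _⟩
  | inter U V _ _ ihU ihV =>
    obtain ⟨F, hF, hFx, hFU⟩ := ihU hx.1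
    obtain ⟨G, hG, hGx, hGV⟩ := ihV hx.2
    exact ⟨F * G, Subalgebra.mul_mem (Algebra.adjoin K _) hF hG, mul_ne_zero hFx hGx, fun y hy =>
      ⟨hFU (left_ne_zero_of_mul hy), hGV (right_ne_zero_of_mul hy)⟩⟩
  | sUnion S _ ih =>
    obtain ⟨U, hUS, hxU⟩ := hx
    obtain ⟨F, hF, hFx, hFU⟩ := ih U hUS hxU
    exact ⟨F, hF, hFx, hFU.trans (Set.subset_sUnion_of_mem hUS)⟩

theorem IsPolyFun.exists_eval_coeff {d n : ℕ} {F : homogeneousSubmodule (Fin n) K d → K}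
    (hF : IsPolyFun K F) : ∃ P : MvPolynomial {s : Fin n →₀ ℕ // s.degree = d} K,
      ∀ p, F p = eval (fun i => coeff i.1 (p : MvPolynomial (Fin n) K)) P := by
  classical
  unfold IsPolyFun at hF
  induction hF using Algebra.adjoin_induction with
  | mem G hG =>
    obtain ⟨l, rfl⟩ := hG
    have : Finite {s : Fin n →₀ ℕ // s.degree = d} := Finsupp.finite_of_degree_eq d
    let _ := Fintype.ofFinite {s : Fin n →₀ ℕ // s.degree = d}
    let e : {s : Fin n →₀ ℕ // s.degree = d} → homogeneousSubmodule (Fin n) K d :=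
      fun i => ⟨monomial i.1 1, isHomogeneous_monomial 1 i.2⟩
    refine ⟨∑ i, C (l (e i)) * X i, fun p => ?_⟩
    have hp : p = ∑ i, coeff i.1 (p : MvPolynomial (Fin n) K) • e i := by
      ext s
      simp only [Submodule.coe_sum, Submodule.coe_smul, e, coeff_sum, coeff_smul, coeff_monomial]
      by_cases hs : s.degree = d
      · rw [Finset.sum_eq_single ⟨s, hs⟩ (fun i _ hi => ?_) (by simp)]
        · simp
        · rw [if_neg fun h => hi (Subtype.ext h), smul_zero]
      · rw [IsHomogeneous.coeff_eq_zero p.2 hs, Finset.sum_eq_zero fun i _ => ?_]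
        rw [if_neg (by rintro rfl; exact hs i.2), smul_zero]
    conv_lhs => rw [hp]
    simp [mul_comm]
  | algebraMap c => exact ⟨C c, fun p => by simp⟩
  | add G H _ _ hG hH =>
    obtain ⟨P, hP⟩ := hG
    obtain ⟨Q, hQ⟩ := hH
    exact ⟨P + Q, fun p => by simp [hP, hQ]⟩
  | mul G H _ _ hG hH =>
    obtain ⟨P, hP⟩ := hG
    obtain ⟨Q, hQ⟩ := hH
    exact ⟨P * Q, fun p => by simp [hP, hQ]⟩

end PolyFun

/-- The restriction of polynomials in `m` variables to the first `n` variables, killing the other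
variables. -/
def truncTo (K : Type) [Field K] (m n : ℕ) : MvPolynomial (Fin m) K →ₐ[K] MvPolynomial (Fin n) K :=
  aeval fun i : Fin m => if h : (i : ℕ) < n then X (⟨i, h⟩ : Fin n) else 0

section Trunc

variable {K : Type} [Field K]

theorem truncTo_truncTo {k n m : ℕ} (h : k ≤ n) (p : MvPolynomial (Fin m) K) :
    truncTo K n k (truncTo K m n p) = truncTo K m k p := by
  have : (truncTo K n k).comp (truncTo K m n) = truncTo K m k := by
    ext i : 1
    by_cases h1 : (i : ℕ) < k
    · simp [truncTo, h1, h1.trans_le h]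
    · by_cases h2 : (i : ℕ) < n <;> simp [truncTo, h1, h2]
  exact DFunLike.congr_fun this p

theorem truncTo_self {n : ℕ} (p : MvPolynomial (Fin n) K) : truncTo K n n p = p := by
  have : truncTo K n n = AlgHom.id K _ := by
    ext i : 1
    simp [truncTo]
  exact DFunLike.congr_fun this p

theorem MvPolynomial.IsHomogeneous.truncTo {m d : ℕ} (n : ℕ) {p : MvPolynomial (Fin m) K}
    (hp : p.IsHomogeneous d) : (truncTo K m n p).IsHomogeneous d := by
  rw [← one_mul d]
  refine hp.aeval _ fun i => ?_
  split_ifs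
  · exact isHomogeneous_X _ _
  · exact isHomogeneous_zero _ _ _

theorem MvPolynomial.IsHomogeneous.polyMapAlg {n m d : ℕ} (φ : (Fin n → K) →ₗ[K] (Fin m → K))
    {p : MvPolynomial (Fin n) K} (hp : p.IsHomogeneous d) :
    (polyMapAlg K φ p).IsHomogeneous d := by
  rw [← one_mul d]
  refine hp.aeval _ fun i => IsHomogeneous.sum _ _ _ fun j _ => ?_
  rw [smul_eq_C_mul, ← zero_add 1]
  exact (isHomogeneous_C _ _).mul (isHomogeneous_X _ _)

theorem StrengthLe.truncTo {d m N : ℕ} (n : ℕ) {p : MvPolynomial (Fin m) K}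
    (hp : StrengthLe K d p N) : StrengthLe K d (truncTo K m n p) N := by
  obtain ⟨k, hk, e, r, s, h1, h2, hr, hs, rfl⟩ := hp
  exact ⟨k, hk, e, fun i => _root_.truncTo K m n (r i), fun i => _root_.truncTo K m n (s i), h1, h2,
    fun i => (hr i).truncTo n, fun i => (hs i).truncTo n, by simp⟩

theorem SdInf.truncTo_eq {d : ℕ} (q : SdInf K d) {n m : ℕ} (h : n ≤ m) :
    truncTo K m n (q.1 m) = (q.1 n : MvPolynomial (Fin n) K) := by
  induction m, h using Nat.le_induction with
  | base => exact truncTo_self _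
  | succ m h ih =>
    rw [← truncTo_truncTo h, ← ih]
    exact congrArg _ (q.2 m)

theorem extendMap_single_of_lt {n₀ m : ℕ} (h : n₀ ≤ m) (g : (Fin n₀ → K) →ₗ[K] (Fin n₀ → K))
    {i : Fin m} (hi : (i : ℕ) < n₀) (j : Fin m) :
    extendMap K h g (Pi.single i 1) j =
      if hj : (j : ℕ) < n₀ then g (Pi.single ⟨i, hi⟩ 1) ⟨j, hj⟩ else 0 := by
  have h1 : (fun j => (Pi.single i 1 : Fin m → K) (Fin.castLE h j)) = Pi.single ⟨i, hi⟩ 1 := by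
    funext k
    simp [Pi.single_apply, Fin.ext_iff]
  change dite _ _ _ = _
  rw [h1]
  split_ifs with hj
  · rfl
  · exact Pi.single_eq_of_ne (by rintro rfl; exact hj hi) _

theorem extendMap_single_of_le {n₀ m : ℕ} (h : n₀ ≤ m) (g : (Fin n₀ → K) →ₗ[K] (Fin n₀ → K))
    {i : Fin m} (hi : n₀ ≤ (i : ℕ)) :
    extendMap K h g (Pi.single i 1) = Pi.single i 1 := by
  have h1 : (fun j => (Pi.single i 1 : Fin m → K) (Fin.castLE h j)) = 0 := by
    funext k
    refine Pi.single_eq_of_ne ?_ _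
    rintro rfl
    exact absurd k.2 (not_lt.mpr hi)
  funext j
  change dite _ _ _ = _
  rw [h1, map_zero]
  split_ifs with hj
  · have hne : j ≠ i := by
      rintro rfl
      exact absurd hj (not_lt.mpr hi)
    rw [Pi.single_eq_of_ne hne]
    rfl
  · rfl

theorem truncTo_polyMapAlg_X {n m l : ℕ} (h : n ≤ m) (φ : (Fin l → K) →ₗ[K] (Fin m → K))
    (i : Fin l) : truncTo K m n (polyMapAlg K φ (X i)) =
      ∑ j : Fin n, φ (Pi.single i 1) (Fin.castLE h j) • X j := by
  obtain ⟨k, rfl⟩ := Nat.exists_eq_add_of_le h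
  rw [polyMapAlg, aeval_X, map_sum, Fin.sum_univ_add]
  simp only [map_smul, truncTo, aeval_X]
  simp
  rfl

theorem truncTo_polyMapAlg_extendMap {n₀ m m' : ℕ} (h : n₀ ≤ m) (h' : m ≤ m')
    (g : (Fin n₀ → K) →ₗ[K] (Fin n₀ → K)) (p : MvPolynomial (Fin m') K) :
    truncTo K m' m (polyMapAlg K (extendMap K (h.trans h') g) p) =
      polyMapAlg K (extendMap K h g) (truncTo K m' m p) := by
  have : (truncTo K m' m).comp (polyMapAlg K (extendMap K (h.trans h') g)) =
      (polyMapAlg K (extendMap K h g)).comp (truncTo K m' m) := by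
    ext i : 1
    rw [AlgHom.comp_apply, truncTo_polyMapAlg_X h', AlgHom.comp_apply, truncTo, aeval_X]
    rcases lt_or_ge (i : ℕ) n₀ with hi | hi
    · rw [dif_pos (hi.trans_le h), polyMapAlg, aeval_X]
      refine Finset.sum_congr rfl fun j _ => ?_
      rw [extendMap_single_of_lt (h.trans h') g hi,
        extendMap_single_of_lt h g (i := ⟨i, hi.trans_le h⟩) hi]
      rfl
    · rw [extendMap_single_of_le _ _ hi]
      split_ifs with him
      · rw [polyMapAlg, aeval_X, extendMap_single_of_le _ _ (i := ⟨i, him⟩) hi]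
        refine Finset.sum_congr rfl fun j _ => ?_
        simp [Pi.single_apply, Fin.ext_iff]
      · rw [map_zero]
        refine Finset.sum_eq_zero fun j _ => ?_
        rw [Pi.single_eq_of_ne, zero_smul]
        rintro rfl
        exact him j.2
  exact DFunLike.congr_fun this p

theorem truncTo_polyMapAlg_eq_linSubst {n m : ℕ} (h : n ≤ m)
    (g : (Fin m → K) →ₗ[K] (Fin m → K)) (p : MvPolynomial (Fin m) K) :
    truncTo K m n (polyMapAlg K (extendMap K le_rfl g) p) =
      linSubst (fun a b => g (Pi.single a 1) (Fin.castLE h b)) p := by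
  have : (truncTo K m n).comp (polyMapAlg K (extendMap K le_rfl g)) =
      linSubst (K := K) fun a b => g (Pi.single a 1) (Fin.castLE h b) := by
    ext i : 1
    rw [AlgHom.comp_apply, truncTo_polyMapAlg_X h, linSubst, aeval_X]
    refine Finset.sum_congr rfl fun j _ => ?_
    rw [extendMap_single_of_lt _ _ i.2, dif_pos (Fin.is_lt _), smul_eq_C_mul]
  exact DFunLike.congr_fun this p

/-- The action of `g ∈ GL_{n₀}` on `S^d_∞`. -/
def SdInf.act {d n₀ : ℕ} (g : (Fin n₀ → K) →ₗ[K] (Fin n₀ → K)) (q : SdInf K d) : SdInf K d where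
  val k := ⟨truncTo K (k + n₀) k
    (polyMapAlg K (extendMap K (Nat.le_add_left n₀ k) g) (q.1 (k + n₀))),
    IsHomogeneous.truncTo k (IsHomogeneous.polyMapAlg _ (q.1 (k + n₀)).2)⟩
  property k := by
    change truncTo K (k + 1) k (truncTo K _ (k + 1) _) = truncTo K _ k _
    rw [truncTo_truncTo (Nat.le_succ k), ← q.truncTo_eq (Nat.add_le_add_right (Nat.le_succ k) n₀),
      ← truncTo_polyMapAlg_extendMap _ (Nat.add_le_add_right (Nat.le_succ k) n₀),
      truncTo_truncTo (Nat.le_add_right k n₀)]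

theorem SdInf.coe_act {d n₀ m : ℕ} (h : n₀ ≤ m) (g : (Fin n₀ → K) →ₗ[K] (Fin n₀ → K))
    (q : SdInf K d) : ((q.act g).1 m : MvPolynomial (Fin m) K) =
      polyMapAlg K (extendMap K h g) (q.1 m) := by
  change truncTo K (m + n₀) m _ = _
  rw [truncTo_polyMapAlg_extendMap h (Nat.le_add_right m n₀),
    q.truncTo_eq (Nat.le_add_right m n₀)]

theorem SdInf.exists_isPolyFun_of_isOpen {d : ℕ} {U : Set (SdInf K d)} (hU : IsOpen U)
    {x : SdInf K d} (hx : x ∈ U) : ∃ (n : ℕ) (F : homogeneousSubmodule (Fin n) K d → K),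
      IsPolyFun K F ∧ F (x.1 n) ≠ 0 ∧ ∀ y : SdInf K d, F (y.1 n) ≠ 0 → y ∈ U := by
  obtain ⟨V, hV, rfl⟩ := isOpen_induced_iff.mp hU
  obtain ⟨I, u, hu, huV⟩ := isOpen_pi_iff.mp hV x.1 hx
  choose! F hF hFx hFu using fun i hi => IsPolyFun.exists_subset_of_isOpen (hu i hi).1 (hu i hi).2
  let n := I.sup id
  let T : ∀ i, homogeneousSubmodule (Fin n) K d →ₗ[K] homogeneousSubmodule (Fin i) K d :=
    fun i => (truncTo K n i).toLinearMap.restrict fun p hp => IsHomogeneous.truncTo i hp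
  have hT : ∀ i ∈ I, ∀ y : SdInf K d, T i (y.1 n) = y.1 i := fun i hi y =>
    Subtype.ext (y.truncTo_eq (Finset.le_sup (f := id) hi))
  refine ⟨n, ∏ i ∈ I, fun p => F i (T i p),
    Subalgebra.prod_mem (Algebra.adjoin K _) fun i hi => (hF i hi).comp_linearMap (T i), ?_, ?_⟩
  · rw [Finset.prod_apply, Finset.prod_ne_zero_iff]
    intro i hi
    rw [hT i hi]
    exact hFx i hi
  · intro y hy
    rw [Finset.prod_apply, Finset.prod_ne_zero_iff] at hy
    refine huV fun i hi => hFu i hi ?_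
    rw [← hT i hi]
    exact hy i hi

end Trunc

/-- **Corollary (orbits of elements of infinite strength are dense).** Fix `d ≥ 2` and let
`K` be a perfect infinite field with `char K = 0` or `char K > d`. If `q ∈ S^d_∞` has
infinite strength (i.e. the strengths of its components are unbounded), then the
`GL_∞`-orbit of `q` is dense in `S^d_∞` for the inverse limit topology. -/
theorem glInfOrbit_dense_of_infinite_strength
    (K : Type) [Field K] [PerfectField K] [Infinite K]
    (d : ℕ) (hd : 2 ≤ d) (hchar : ringChar K = 0 ∨ d < ringChar K)
    (q : SdInf K d)
    (hq : ∀ N : ℕ, ∃ n : ℕ, ¬ StrengthLe K d (↑(q.1 n) : MvPolynomial (Fin n) K) N) :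
    Dense (glInfOrbit K d q) := by
  rw [dense_iff_inter_open]
  rintro U hU ⟨x, hx⟩
  obtain ⟨n, F, hF, hFx, hFU⟩ := SdInf.exists_isPolyFun_of_isOpen hU hx
  obtain ⟨P, hP⟩ := hF.exists_eval_coeff
  have hP0 : P ≠ 0 := by
    rintro rfl
    exact hFx (by rw [hP, map_zero])
  by_contra hempty
  obtain ⟨k, hk⟩ := hq (Nat.card ({s : Fin n →₀ ℕ // s.degree = d} × Fin (d - 1)))
  apply hk
  rw [← q.truncTo_eq (le_max_left k n)]
  refine StrengthLe.truncTo k (strengthLe_of_vanishing_orbit hd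
    (factorial_cast_ne_zero_of_lt_ringChar hchar) (q.1 (max k n)).2 hP0
    (eval_coeff_linSubst_eq_zero_of_linearEquiv (le_max_right k n) _ P _ fun g => ?_))
  by_contra hne
  refine hempty ⟨q.act g.toLinearMap, hFU _ ?_, _, g, fun m h => q.coe_act h g.toLinearMap⟩
  rw [hP, ← (q.act g.toLinearMap).truncTo_eq (le_max_right k n), q.coe_act le_rfl,
    truncTo_polyMapAlg_eq_linSubst (le_max_right k n)]
  exact hne

end
end
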